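/- Let r be a power of p and m = (m_j)_{j≥0} an integer sequence with m_0 = 1 and m_j ≥ 2 for all j ≥ 1. Then the *-type of ξ(r,m) satisfies limsup_{j→∞} (2 m_j − 1) ≤ t*(ξ(r,m)) ≤ limsup_{j→∞} (m_j + 2 m_j m_{j+1} ⋯ m_{j+p}). -/

import Mathlib

open Polynomial Filter Set
open scoped Classical

noncomputable section

namespace OotoT

variable (Fq : Type) [Field Fq]

/-- We model the field `F_q((T⁻¹))` of Laurent series in `T⁻¹` as `LaurentSeries Fq`,
whose canonical variable `u` plays the role of `T⁻¹`.  Thus `T` itself is `u⁻¹`. -/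
def Tel : LaurentSeries Fq := (HahnSeries.single (1 : ℤ) (1 : Fq))⁻¹

/-- The canonical ring embedding `F_q[T] → F_q((T⁻¹))`, sending `T ↦ u⁻¹`. -/
def ringHomT : Polynomial Fq →+* LaurentSeries Fq :=
  Polynomial.eval₂RingHom (HahnSeries.C : Fq →+* LaurentSeries Fq) (Tel Fq)

/-- The absolute value on `F_q((T⁻¹))`: `|0| = 0` and `|ξ| = q^{-N}` where
`ξ = Σ_{n ≥ N} a_n T^{-n}` with `a_N ≠ 0`; in our model `N` is the order of `ξ`
as a Hahn series in `u = T⁻¹`. -/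
def absL (q : ℕ) (ξ : LaurentSeries Fq) : ℝ :=
  if ξ = 0 then 0 else (q : ℝ) ^ (-ξ.order)

/-- Evaluation of a polynomial `P(X) ∈ (F_q[T])[X]` at `ξ ∈ F_q((T⁻¹))`. -/
def evalP (ξ : LaurentSeries Fq) (P : Polynomial (Polynomial Fq)) : LaurentSeries Fq :=
  Polynomial.eval₂ (ringHomT Fq) ξ P

/-- The height of `P(X) ∈ (F_q[T])[X]`: the maximum of the absolute values of its
coefficients.  A nonzero `c ∈ F_q[T]` has `|c| = q^{deg c}`, so for `P ≠ 0` the height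
is `q` raised to the maximal degree of a (nonzero) coefficient of `P`. -/
def heightP (q : ℕ) (P : Polynomial (Polynomial Fq)) : ℝ :=
  if P = 0 then 0 else (q : ℝ) ^ (P.support.sup fun i => (P.coeff i).natDegree)

/-- `w_n(ξ)`: the supremum (in the extended reals) of the real numbers `w` such that
`0 < |P(ξ)| ≤ H(P)^{-w}` for infinitely many `P(X) ∈ (F_q[T])[X]` of degree at most `n`. -/
def wn (q : ℕ) (n : ℕ) (ξ : LaurentSeries Fq) : EReal :=
  sSup ((fun w : ℝ => (w : EReal)) ''
    {w : ℝ | {P : Polynomial (Polynomial Fq) | P.natDegree ≤ n ∧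
      0 < absL Fq q (evalP Fq ξ P) ∧
      absL Fq q (evalP Fq ξ P) ≤ heightP Fq q P ^ (-w)}.Infinite})

/-- `w(ξ) = limsup_{n→∞} w_n(ξ)/n`. -/
def wB (q : ℕ) (ξ : LaurentSeries Fq) : EReal :=
  Filter.limsup (fun n : ℕ => wn Fq q n ξ / (n : EReal)) Filter.atTop

/-- `ξ` is an `A`-number if `w(ξ) = 0`. -/
def IsANumber (q : ℕ) (ξ : LaurentSeries Fq) : Prop := wB Fq q ξ = 0

/-- `ξ` is an `S`-number if `0 < w(ξ) < +∞`. -/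
def IsSNumber (q : ℕ) (ξ : LaurentSeries Fq) : Prop := 0 < wB Fq q ξ ∧ wB Fq q ξ < ⊤

/-- `ξ` is a `T`-number if `w(ξ) = +∞` and `w_n(ξ) < +∞` for all `n ≥ 1`. -/
def IsTNumber (q : ℕ) (ξ : LaurentSeries Fq) : Prop :=
  wB Fq q ξ = ⊤ ∧ ∀ n : ℕ, 1 ≤ n → wn Fq q n ξ < ⊤

/-- `ξ` is a `U`-number if `w(ξ) = +∞` and `w_n(ξ) = +∞` for some `n ≥ 1`. -/
def IsUNumber (q : ℕ) (ξ : LaurentSeries Fq) : Prop :=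
  wB Fq q ξ = ⊤ ∧ ∃ n : ℕ, 1 ≤ n ∧ wn Fq q n ξ = ⊤

/-- The type `t(ξ) = limsup_{n→∞} (log w_n(ξ))/(log n)` of a `T`-number (as an
extended real; for a `T`-number each `w_n(ξ)` is a finite real, recovered by `toReal`). -/
def typeT (q : ℕ) (ξ : LaurentSeries Fq) : EReal :=
  Filter.limsup
    (fun n : ℕ => ((Real.log (wn Fq q n ξ).toReal / Real.log n : ℝ) : EReal)) Filter.atTop

/-! ### The algebraic closure side -/

/-- The algebraic closure of `F_q((T⁻¹))`. -/
abbrev AC := AlgebraicClosure (LaurentSeries Fq)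

/-- The canonical embedding of `F_q((T⁻¹))` into its algebraic closure. -/
def iota : LaurentSeries Fq →+* AC Fq := algebraMap _ _

/-- The embedding `F_q[T] → AC`. -/
def ringHomTC : Polynomial Fq →+* AC Fq := (iota Fq).comp (ringHomT Fq)

/-- Evaluation of `P(X) ∈ (F_q[T])[X]` at an element of the algebraic closure. -/
def evalPC (α : AC Fq) (P : Polynomial (Polynomial Fq)) : AC Fq :=
  Polynomial.eval₂ (ringHomTC Fq) α P

/-- `P ∈ (F_q[T])[X]` is *the* minimal polynomial of `α`: it is non-constant, irreducible,
primitive, its leading coefficient is monic (in `T`), and `P(α) = 0`.  For `α` algebraic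
over `F_q(T)` such a polynomial exists and is unique. -/
def IsMinPolyOf (α : AC Fq) (P : Polynomial (Polynomial Fq)) : Prop :=
  0 < P.natDegree ∧ Irreducible P ∧ P.IsPrimitive ∧ P.leadingCoeff.Monic ∧ evalPC Fq α P = 0

/-- `α` is algebraic over `F_q(T)`. -/
def IsAlgT (α : AC Fq) : Prop := ∃ P, IsMinPolyOf Fq α P

/-- The degree of an algebraic `α`: the degree of its minimal polynomial. -/
def degT (α : AC Fq) : ℕ := if h : IsAlgT Fq α then h.choose.natDegree else 0

/-- The height of an algebraic `α`: the height of its minimal polynomial. -/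
def heightT (q : ℕ) (α : AC Fq) : ℝ := if h : IsAlgT Fq α then heightP Fq q h.choose else 0

/-- The unique extension of the absolute value to the algebraic closure of `F_q((T⁻¹))`,
given by the standard formula `|x| = |N_{K(x)/K}(x)|^{1/[K(x):K]}`, i.e.
`|x| = |c₀|^{1/d}` where `c₀` is the constant coefficient and `d` the degree of the
minimal polynomial of `x` over `K = F_q((T⁻¹))`. -/
def absC (q : ℕ) (x : AC Fq) : ℝ :=
  absL Fq q ((minpoly (LaurentSeries Fq) x).coeff 0) ^
    (((minpoly (LaurentSeries Fq) x).natDegree : ℝ)⁻¹)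

/-- `w_n^*(ξ)`: the supremum (in the extended reals) of the real numbers `w` such that
`0 < |ξ - α| ≤ H(α)^{-w-1}` for infinitely many `α` algebraic over `F_q(T)` of degree
at most `n`. -/
def wnStar (q : ℕ) (n : ℕ) (ξ : LaurentSeries Fq) : EReal :=
  sSup ((fun w : ℝ => (w : EReal)) ''
    {w : ℝ | {α : AC Fq | IsAlgT Fq α ∧ degT Fq α ≤ n ∧
      0 < absC Fq q (iota Fq ξ - α) ∧
      absC Fq q (iota Fq ξ - α) ≤ heightT Fq q α ^ (-w - 1)}.Infinite})

/-- `w^*(ξ) = limsup_{n→∞} w_n^*(ξ)/n`. -/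
def wBStar (q : ℕ) (ξ : LaurentSeries Fq) : EReal :=
  Filter.limsup (fun n : ℕ => wnStar Fq q n ξ / (n : EReal)) Filter.atTop

/-- `ξ` is an `A*`-number if `w^*(ξ) = 0`. -/
def IsAStarNumber (q : ℕ) (ξ : LaurentSeries Fq) : Prop := wBStar Fq q ξ = 0

/-- `ξ` is a `T*`-number if `w^*(ξ) = +∞` and `w_n^*(ξ) < +∞` for all `n ≥ 1`. -/
def IsTStarNumber (q : ℕ) (ξ : LaurentSeries Fq) : Prop :=
  wBStar Fq q ξ = ⊤ ∧ ∀ n : ℕ, 1 ≤ n → wnStar Fq q n ξ < ⊤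

/-- The `*`-type `t^*(ξ) = limsup_{n→∞} (log w_n^*(ξ))/(log n)` of a `T*`-number. -/
def typeTStar (q : ℕ) (ξ : LaurentSeries Fq) : EReal :=
  Filter.limsup
    (fun n : ℕ => ((Real.log (wnStar Fq q n ξ).toReal / Real.log n : ℝ) : EReal)) Filter.atTop

/-! ### The Laurent series `ξ(r, m)` -/

/-- `r_j = r^{m_0 m_1 ⋯ m_j}`. -/
def rr (r : ℕ) (m : ℕ → ℕ) (j : ℕ) : ℕ := r ^ (∏ i ∈ Finset.range (j + 1), m i)

/-- `α_j(r, m) = Σ_{n=1}^∞ T^{-r_j^n}`, i.e. the power series in `u = T⁻¹` whose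
`k`-th coefficient is `1` exactly when `k = r_j^n` for some `n ≥ 1`. -/
def alphaJ (r : ℕ) (m : ℕ → ℕ) (j : ℕ) : LaurentSeries Fq :=
  HahnSeries.ofPowerSeries ℤ Fq (PowerSeries.mk fun k =>
    if ∃ n : ℕ, 1 ≤ n ∧ k = rr r m j ^ n then 1 else 0)

/-- `ξ_a(r, m) = Σ_{j=0}^∞ a_j α_j(r, m)`, described coefficientwise: the coefficient of
`T^{-k}` is the (finite) sum over `j` of `a_j` times the coefficient of `T^{-k}` in
`α_j(r, m)`. -/
def xiA (r : ℕ) (m : ℕ → ℕ) (a : ℕ → ℕ) : LaurentSeries Fq :=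
  HahnSeries.ofPowerSeries ℤ Fq (PowerSeries.mk fun k =>
    ∑ᶠ j : ℕ, (a j : Fq) * (if ∃ n : ℕ, 1 ≤ n ∧ k = rr r m j ^ n then 1 else 0))

/-- `ξ(r, m) = Σ_{j=0}^∞ α_j(r, m)`. -/
def xi (r : ℕ) (m : ℕ → ℕ) : LaurentSeries Fq := xiA Fq r m fun _ => 1

/-! ### Algebraicity and algebraic dependence over `F_q(T)` for Laurent series -/

/-- `ξ ∈ F_q((T⁻¹))` is algebraic over `F_q(T)`. -/
def IsAlgLS (ξ : LaurentSeries Fq) : Prop :=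
  ∃ P : Polynomial (Polynomial Fq), P ≠ 0 ∧ evalP Fq ξ P = 0

/-- Evaluation of a two-variable polynomial `F(X, Y) ∈ (F_q[T])[X, Y]` (coded as an
iterated polynomial ring, `T` innermost, then `X`, then `Y`) at `(ξ, η)`. -/
def evalXY (ξ η : LaurentSeries Fq) (F : Polynomial (Polynomial (Polynomial Fq))) :
    LaurentSeries Fq :=
  Polynomial.eval₂ (Polynomial.eval₂RingHom (ringHomT Fq) ξ) η F

/-- `ξ` and `η` are algebraically dependent over `F_q(T)`. -/
def AlgDep (ξ η : LaurentSeries Fq) : Prop :=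
  ∃ F : Polynomial (Polynomial (Polynomial Fq)), F ≠ 0 ∧ evalXY Fq ξ η F = 0

/-- `deg_X` of `F(X, Y) ∈ (F_q[T])[X, Y]` in our encoding. -/
def degX (F : Polynomial (Polynomial (Polynomial Fq))) : ℕ :=
  F.support.sup fun i => (F.coeff i).natDegree

/-- `F(X, Y) ∈ (F_q[T])[X, Y]` is primitive (in `X` and `Y`): no non-unit of `F_q[T]`
divides all of its coefficients. -/
def IsPrimitiveXY (F : Polynomial (Polynomial (Polynomial Fq))) : Prop :=
  ∀ c : Polynomial Fq, (∀ i j : ℕ, c ∣ ((F.coeff i).coeff j)) → IsUnit c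

end OotoT

open OotoT

namespace OotoT

variable {Fq : Type} [Field Fq]

/-- A complete nontrivial nonarchimedean absolute value on a field extends to its algebraic
closure, by the norm formula. -/
theorem exists_absoluteValue_algebraicClosure {K : Type*} [Field K] (v : AbsoluteValue K ℝ)
    (hna : IsNonarchimedean v) (hnt : ∃ x, 1 < v x)
    (hc : ∀ u : ℕ → K, (∀ ε > 0, ∃ N, ∀ m ≥ N, ∀ n ≥ N, v (u m - u n) < ε) →
      ∃ x, ∀ ε > 0, ∃ N, ∀ n ≥ N, v (u n - x) < ε) :
    ∃ w : AbsoluteValue (AlgebraicClosure K) ℝ, IsNonarchimedean w ∧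
      (∀ x, w (algebraMap K _ x) = v x) ∧
      ∀ y, w y = v ((minpoly K y).coeff 0) ^ (((minpoly K y).natDegree : ℝ)⁻¹) := by
  let _ : NontriviallyNormedField K := { v.toNormedField with non_trivial := hnt }
  have hnorm : ∀ x : K, ‖x‖ = v x := fun _ => rfl
  have hdist : ∀ x y : K, dist x y = v (x - y) := fun x y => by rw [dist_eq_norm, hnorm]
  have : IsUltrametricDist K := IsUltrametricDist.isUltrametricDist_of_isNonarchimedean_norm hna
  have : CompleteSpace K := by
    refine Metric.complete_of_cauchySeq_tendsto fun u hu => ?_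
    obtain ⟨x, hx⟩ := hc u fun ε hε => by
      simpa only [hdist] using Metric.cauchySeq_iff.1 hu ε hε
    exact ⟨x, Metric.tendsto_atTop.2 fun ε hε => by simpa only [hdist] using hx ε hε⟩
  let f := spectralMulAlgNorm K (AlgebraicClosure K)
  refine ⟨⟨⟨f, map_mul f⟩, fun x => apply_nonneg f x, fun x => map_eq_zero_iff_eq_zero f,
    fun x y => map_add_le_add f x y⟩, ?_, ?_, ?_⟩
  · exact isNonarchimedean_spectralNorm
  · exact fun x => spectralNorm_extends x
  · intro y
    have := spectralNorm.spectralNorm_eq_norm_coeff_zero_rpow K (AlgebraicClosure K) y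
    rw [one_div] at this
    exact this

/-- `|x| ≤ q^{-n}` exactly when all coefficients below `n` vanish. -/
theorem absL_le_zpow_iff {q : ℕ} (hq : 1 < q) (x : LaurentSeries Fq) (n : ℤ) :
    absL Fq q x ≤ (q : ℝ) ^ (-n) ↔ ∀ k < n, x.coeff k = 0 := by
  have hq' : (1 : ℝ) < q := by exact_mod_cast hq
  unfold absL
  split_ifs with h
  · subst h
    simp only [HahnSeries.coeff_zero, implies_true, iff_true]
    positivity
  · rw [zpow_le_zpow_iff_right₀ hq', neg_le_neg_iff]
    refine ⟨fun hn k hk => HahnSeries.coeff_eq_zero_of_lt_order (hk.trans_le hn), fun H => ?_⟩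
    by_contra! hlt
    exact h (HahnSeries.coeff_order_eq_zero.1 (H _ hlt))

theorem absL_nonneg (q : ℕ) (x : LaurentSeries Fq) : 0 ≤ absL Fq q x := by
  unfold absL; split_ifs <;> positivity

theorem absL_add_le_max {q : ℕ} (hq : 1 < q) (x y : LaurentSeries Fq) :
    absL Fq q (x + y) ≤ max (absL Fq q x) (absL Fq q y) := by
  wlog h : absL Fq q x ≤ absL Fq q y generalizing x y
  · rw [add_comm, max_comm]
    exact this y x (le_of_not_ge h)
  rw [max_eq_right h]
  by_cases hy : y = 0
  · have hx : x = 0 := by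
      by_contra hx
      have : 0 < absL Fq q x := by simp only [absL, hx, if_false]; positivity
      have h0 : absL Fq q y = 0 := by simp [absL, hy]
      linarith
    simp [hx, hy]
  · have hy' : absL Fq q y = (q : ℝ) ^ (-y.order) := by simp only [absL, hy, if_false]
    rw [hy'] at h ⊢
    rw [absL_le_zpow_iff hq] at h ⊢
    intro k hk
    rw [HahnSeries.coeff_add, h k hk, HahnSeries.coeff_eq_zero_of_lt_order hk, add_zero]

/-- The absolute value `absL`, bundled. -/
def absLV (Fq : Type) [Field Fq] {q : ℕ} (hq : 1 < q) : AbsoluteValue (LaurentSeries Fq) ℝ where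
  toFun := absL Fq q
  map_mul' x y := by
    have hq0 : (q : ℝ) ≠ 0 := by positivity
    by_cases hx : x = 0
    · simp [absL, hx]
    by_cases hy : y = 0
    · simp [absL, hy]
    simp only [absL, hx, hy, mul_eq_zero, or_self, if_false]
    rw [HahnSeries.order_mul hx hy, neg_add, zpow_add₀ hq0]
  nonneg' x := absL_nonneg q x
  eq_zero' x := by
    have hq0 : (q : ℝ) ≠ 0 := by positivity
    unfold absL
    split_ifs with h
    · simp [h]
    · simp [h, zpow_ne_zero _ hq0]
  add_le' x y := (absL_add_le_max hq x y).trans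
    (max_le (le_add_of_nonneg_right (absL_nonneg q y)) (le_add_of_nonneg_left (absL_nonneg q x)))

theorem absLV_apply {q : ℕ} (hq : 1 < q) (x : LaurentSeries Fq) :
    absLV Fq hq x = absL Fq q x := rfl

theorem absL_single {q : ℕ} (n : ℤ) (c : Fq) (hc : c ≠ 0) :
    absL Fq q (HahnSeries.single n c) = (q : ℝ) ^ (-n) := by
  have : HahnSeries.single n c ≠ 0 := by simpa using hc
  simp only [absL, this, if_false, HahnSeries.order_single hc]

/-- Cauchy sequences for `absL` converge. -/
theorem absL_complete {q : ℕ} (hq : 1 < q) (u : ℕ → LaurentSeries Fq)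
    (hu : ∀ ε > 0, ∃ N, ∀ m ≥ N, ∀ n ≥ N, absL Fq q (u m - u n) < ε) :
    ∃ x, ∀ ε > 0, ∃ N, ∀ n ≥ N, absL Fq q (u n - x) < ε := by
  have hq' : (1 : ℝ) < q := by exact_mod_cast hq
  have hstab : ∀ D : ℤ, ∃ N, ∀ n ≥ N, ∀ k < D, (u n).coeff k = (u N).coeff k := by
    intro D
    obtain ⟨N, hN⟩ := hu ((q : ℝ) ^ (-D)) (by positivity)
    refine ⟨N, fun n hn k hk => ?_⟩
    have := (absL_le_zpow_iff hq _ D).1 (hN n hn N le_rfl).le k hk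
    rwa [HahnSeries.coeff_sub, sub_eq_zero] at this
  choose N hN using hstab
  have hlim : ∀ D : ℤ, ∀ n ≥ N D, ∀ k < D, (u n).coeff k = (u (N (k + 1))).coeff k := by
    intro D n hn k hk
    have h1 := hN D (max (N D) (N (k + 1))) (le_max_left _ _) k hk
    have h2 := hN (k + 1) (max (N D) (N (k + 1))) (le_max_right _ _) k (by lia)
    rw [hN D n hn k hk, ← h1, h2]
  let c : ℤ → Fq := fun k => (u (N (k + 1))).coeff k
  have hc : BddBelow (Function.support c) := by
    refine ⟨min 0 (u (N 0)).order, fun k hk => ?_⟩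
    by_contra! hlt
    refine hk ?_
    change (u (N (k + 1))).coeff k = 0
    rw [← hlim 0 (N 0) le_rfl k (hlt.trans_le (min_le_left _ _))]
    exact HahnSeries.coeff_eq_zero_of_lt_order (hlt.trans_le (min_le_right _ _))
  refine ⟨HahnSeries.ofSuppBddBelow c hc, fun ε hε => ?_⟩
  obtain ⟨D, hD⟩ := exists_pow_lt_of_lt_one hε (inv_lt_one_of_one_lt₀ hq')
  refine ⟨N D, fun n hn => lt_of_le_of_lt ?_ hD⟩
  rw [inv_pow, ← zpow_natCast, ← zpow_neg, absL_le_zpow_iff hq]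
  intro k hk
  rw [HahnSeries.coeff_sub, sub_eq_zero, hlim D n hn k hk]
  rfl

/-- `absC` is a nonarchimedean absolute value extending `absL`. -/
theorem exists_absC_absoluteValue (Fq : Type) [Field Fq] {q : ℕ} (hq : 1 < q) :
    ∃ w : AbsoluteValue (AC Fq) ℝ, IsNonarchimedean w ∧
      (∀ x, w (iota Fq x) = absL Fq q x) ∧ ∀ y, w y = absC Fq q y := by
  refine exists_absoluteValue_algebraicClosure (absLV Fq hq) (absL_add_le_max hq)
    ⟨HahnSeries.single (-1) 1, ?_⟩ (absL_complete hq)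
  rw [absLV_apply, absL_single _ _ one_ne_zero]
  simpa using hq

theorem absL_eq_zpow {q : ℕ} (x : LaurentSeries Fq) (n : ℤ)
    (h0 : ∀ k < n, x.coeff k = 0) (h1 : x.coeff n ≠ 0) : absL Fq q x = (q : ℝ) ^ (-n) := by
  have hx : x ≠ 0 := fun h => h1 (by simp [h])
  have : x.order = n := by
    refine le_antisymm (HahnSeries.order_le_of_coeff_ne_zero h1) ?_
    by_contra! hlt
    exact hx (HahnSeries.coeff_order_eq_zero.1 (h0 _ hlt))
  simp only [absL, hx, if_false, this]

theorem Tel_pow (k : ℕ) : Tel Fq ^ k = HahnSeries.single (-(k : ℤ)) 1 := by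
  rw [Tel, HahnSeries.inv_single, HahnSeries.single_pow]
  simp

theorem coeff_ringHomT (c : Polynomial Fq) (n : ℤ) :
    (ringHomT Fq c).coeff n = if n ≤ 0 then c.coeff n.natAbs else 0 := by
  induction c using Polynomial.induction_on' with
  | add a b ha hb =>
    rw [map_add, HahnSeries.coeff_add, ha, hb]
    split_ifs <;> simp
  | monomial k a =>
    have : ringHomT Fq (monomial k a) = HahnSeries.single (-(k : ℤ)) a := by
      rw [ringHomT, coe_eval₂RingHom, eval₂_monomial, Tel_pow, HahnSeries.C_apply,
        HahnSeries.single_mul_single]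
      simp
    rw [this, HahnSeries.coeff_single, coeff_monomial]
    by_cases hn : n ≤ 0
    · simp only [hn, if_true]
      congr 1
      exact propext (by lia)
    · simp only [hn, if_false]
      rw [if_neg (by lia)]

theorem absL_ringHomT {q : ℕ} {c : Polynomial Fq} (hc : c ≠ 0) :
    absL Fq q (ringHomT Fq c) = (q : ℝ) ^ c.natDegree := by
  rw [absL_eq_zpow _ (-(c.natDegree : ℤ)), neg_neg, zpow_natCast]
  · intro k hk
    rw [coeff_ringHomT, if_pos (by lia), coeff_eq_zero_of_natDegree_lt (by lia)]
  · rw [coeff_ringHomT, if_pos (by lia)]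
    simpa using hc

theorem ringHomTC_injective : Function.Injective (ringHomTC Fq) := by
  refine (iota Fq).injective.comp ((injective_iff_map_eq_zero _).2 fun c hc => ?_)
  by_contra h
  have := absL_ringHomT (q := 2) h
  simp only [hc, absL, if_true] at this
  have h2 : (0 : ℝ) < ((2 : ℕ) : ℝ) ^ c.natDegree := by positivity
  linarith

/-- The exponent of the height of a polynomial over `F_q[T]`. -/
def heightExp (P : Polynomial (Polynomial Fq)) : ℕ :=
  P.support.sup fun i => (P.coeff i).natDegree

theorem heightP_eq {P : Polynomial (Polynomial Fq)} (q : ℕ) (hP : P ≠ 0) :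
    heightP Fq q P = (q : ℝ) ^ heightExp P := by
  simp [heightP, hP, heightExp]

theorem evalPC_eq_eval_map (α : AC Fq) (P : Polynomial (Polynomial Fq)) :
    evalPC Fq α P = (P.map (ringHomTC Fq)).eval α := by
  rw [evalPC, eval_map]

theorem dvd_of_evalPC_eq_zero {α : AC Fq} {P Q : Polynomial (Polynomial Fq)}
    (hirr : Irreducible P) (hdeg : 0 < P.natDegree)
    (hP : evalPC Fq α P = 0) (hQ : evalPC Fq α Q = 0) : P ∣ Q := by
  let K := FractionRing (Polynomial Fq)
  let φ : K →+* AC Fq := IsFractionRing.lift (ringHomTC_injective (Fq := Fq))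
  have hφ : φ.comp (algebraMap (Polynomial Fq) K) = ringHomTC Fq := by
    ext x <;> simp [φ]
  have hprim : P.IsPrimitive := hirr.isPrimitive hdeg.ne'
  have hirrK : Irreducible (P.map (algebraMap _ K)) :=
    hprim.irreducible_iff_irreducible_map_fraction_map.1 hirr
  have hev : ∀ S : Polynomial (Polynomial Fq), evalPC Fq α S = 0 →
      (S.map (algebraMap _ K)).eval₂ φ α = 0 := by
    intro S hS
    rwa [eval₂_map, hφ]
  by_contra hnd
  have hnd' : ¬ P.map (algebraMap _ K) ∣ Q.map (algebraMap _ K) := by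
    intro h
    by_cases hQ0 : Q = 0
    · exact hnd (hQ0 ▸ dvd_zero _)
    exact hnd (hprim.dvd_of_fraction_map_dvd_fraction_map (K := K) h)
  obtain ⟨a, b, hab⟩ := (hirrK.coprime_iff_not_dvd).2 hnd'
  have := congrArg (eval₂ φ α) hab
  simp [hev P hP, hev Q hQ] at this

theorem absoluteValue_ringHomTC {q : ℕ} {w : AbsoluteValue (AC Fq) ℝ}
    (hw : ∀ x, w (iota Fq x) = absL Fq q x) {c : Polynomial Fq} (hc : c ≠ 0) :
    w (ringHomTC Fq c) = (q : ℝ) ^ c.natDegree := by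
  rw [ringHomTC, RingHom.comp_apply, hw, absL_ringHomT hc]

theorem gaussNorm_map_eq {q : ℕ} (hq : 1 < q) {w : AbsoluteValue (AC Fq) ℝ}
    (hw : ∀ x, w (iota Fq x) = absL Fq q x)
    {P : Polynomial (Polynomial Fq)}
    (hP : P ≠ 0) :
    (P.map (ringHomTC Fq)).gaussNorm w 1 = (q : ℝ) ^ heightExp P := by
  have hq' : (1 : ℝ) < q := by exact_mod_cast hq
  apply le_antisymm
  · obtain ⟨i, hi⟩ := (P.map (ringHomTC Fq)).exists_eq_gaussNorm w 1
    rw [hi, coeff_map, one_pow, mul_one]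
    by_cases h0 : P.coeff i = 0
    · rw [h0, map_zero, map_zero]; positivity
    · rw [absoluteValue_ringHomTC hw h0]
      exact pow_le_pow_right₀ hq'.le
        (Finset.le_sup (f := fun i => (P.coeff i).natDegree) (mem_support_iff.2 h0))
  · obtain ⟨i, hi, h⟩ := Finset.exists_mem_eq_sup P.support (nonempty_support_iff.2 hP)
      (fun i => (P.coeff i).natDegree)
    rw [heightExp, h, ← absoluteValue_ringHomTC hw (mem_support_iff.1 hi), ← coeff_map]
    simpa using (P.map (ringHomTC Fq)).le_gaussNorm w zero_le_one i

theorem heightExp_mul {q : ℕ} (hq : 1 < q) {w : AbsoluteValue (AC Fq) ℝ}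
    (hna : IsNonarchimedean w) (hw : ∀ x, w (iota Fq x) = absL Fq q x)
    {P Q : Polynomial (Polynomial Fq)}
    (hP : P ≠ 0) (hQ : Q ≠ 0) :
    heightExp (P * Q) = heightExp P + heightExp Q := by
  have hq' : (1 : ℝ) < q := by exact_mod_cast hq
  have := gaussNorm_mul hna one_pos (P.map (ringHomTC Fq)) (Q.map (ringHomTC Fq))
  rw [← Polynomial.map_mul, gaussNorm_map_eq hq hw hP, gaussNorm_map_eq hq hw hQ,
    gaussNorm_map_eq hq hw (mul_ne_zero hP hQ), ← pow_add] at this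
  exact pow_right_injective₀ (by positivity) hq'.ne' this

theorem prod_max_one_le_gaussNorm {L : Type*} [Field L] {w : AbsoluteValue L ℝ}
    (hna : IsNonarchimedean w) (s : Multiset L) :
    (s.map fun b => max 1 (w b)).prod ≤ (s.map fun b => X - C b).prod.gaussNorm w 1 := by
  induction s using Multiset.induction_on with
  | empty =>
    rw [Multiset.map_zero, Multiset.map_zero, Multiset.prod_zero, Multiset.prod_zero, ← C_1,
      Polynomial.gaussNorm_C, map_one]
  | cons b s ih =>
    rw [Multiset.map_cons, Multiset.map_cons, Multiset.prod_cons, Multiset.prod_cons,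
      gaussNorm_mul hna one_pos]
    refine mul_le_mul (max_le ?_ ?_) ih ?_ (gaussNorm_nonneg _ _ zero_le_one)
    · have h := (X - C b).le_gaussNorm w zero_le_one 1
      rwa [coeff_sub, coeff_X_one, coeff_C_succ, sub_zero, map_one, one_pow, mul_one] at h
    · have h := (X - C b).le_gaussNorm w zero_le_one 0
      rwa [coeff_sub, coeff_X_zero, coeff_C_zero, zero_sub, AbsoluteValue.map_neg, pow_zero,
        mul_one] at h
    · refine Multiset.prod_nonneg fun x hx => ?_
      obtain ⟨b, -, rfl⟩ := Multiset.mem_map.1 hx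
      positivity

/-- The Mahler measure of a polynomial is bounded by its height. -/
theorem leadingCoeff_mul_prod_max_one_le {L : Type*} [Field L] [IsAlgClosed L]
    {w : AbsoluteValue L ℝ} (hna : IsNonarchimedean w) (P : L[X]) :
    w P.leadingCoeff * (P.roots.map fun b => max 1 (w b)).prod ≤ P.gaussNorm w 1 := by
  conv_rhs => rw [(IsAlgClosed.splits P).eq_prod_roots]
  rw [gaussNorm_mul hna one_pos, Polynomial.gaussNorm_C]
  exact mul_le_mul_of_nonneg_left (prod_max_one_le_gaussNorm hna _) (w.nonneg _)

/-- The polynomial `T^E (X^R - X) + c`. -/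
def artinSchreier (E R : ℕ) (c : Polynomial Fq) : Polynomial (Polynomial Fq) :=
  C (X ^ E) * (X ^ R - X) + C c

theorem evalPC_artinSchreier (E R : ℕ) (c : Polynomial Fq) (β : AC Fq) :
    evalPC Fq β (artinSchreier E R c) =
      ringHomTC Fq (X ^ E) * (β ^ R - β) + ringHomTC Fq c := by
  simp [evalPC, artinSchreier, eval₂_add, eval₂_mul, eval₂_sub, eval₂_pow]

theorem natDegree_artinSchreier {E R : ℕ} (hR : 1 < R) (c : Polynomial Fq) :
    (artinSchreier E R c).natDegree = R := by
  rw [artinSchreier, natDegree_add_C, natDegree_C_mul (pow_ne_zero _ X_ne_zero)]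
  compute_degree!
  · simp [hR.ne]
  · exact hR.le

theorem artinSchreier_ne_zero {E R : ℕ} (hR : 1 < R) (c : Polynomial Fq) :
    artinSchreier E R c ≠ 0 := by
  intro h
  have := natDegree_artinSchreier (E := E) hR c
  rw [h, natDegree_zero] at this
  lia

theorem heightExp_artinSchreier_le {E R : ℕ} {c : Polynomial Fq}
    (hc : c.natDegree ≤ E) : heightExp (artinSchreier E R c) ≤ E := by
  refine Finset.sup_le fun i _ => ?_
  rw [artinSchreier, coeff_add, coeff_C_mul, coeff_sub, coeff_X_pow, coeff_X, coeff_C]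
  refine (natDegree_add_le _ _).trans (max_le ?_ ?_)
  · refine natDegree_mul_le.trans ?_
    rw [natDegree_X_pow]
    have : ((if i = R then 1 else 0) - (if 1 = i then 1 else 0) : Polynomial Fq).natDegree = 0 := by
      split_ifs <;> simp
    lia
  · split_ifs
    · exact hc
    · simp

theorem absoluteValue_evalPC_artinSchreier_le {q : ℕ} (hq : 1 < q) {w : AbsoluteValue (AC Fq) ℝ}
    (hna : IsNonarchimedean w) (hw : ∀ x, w (iota Fq x) = absL Fq q x) {E R : ℕ} (hR : 1 < R)
    {c : Polynomial Fq} (hc : c.natDegree ≤ E) (β : AC Fq) :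
    w (evalPC Fq β (artinSchreier E R c)) ≤ (q : ℝ) ^ E * max 1 (w β) ^ R := by
  have hq' : (1 : ℝ) < q := by exact_mod_cast hq
  have h1 : (1 : ℝ) ≤ max 1 (w β) := le_max_left _ _
  have hm : (1 : ℝ) ≤ max 1 (w β) ^ R := one_le_pow₀ h1
  rw [evalPC_artinSchreier]
  refine (hna _ _).trans (max_le ?_ ?_)
  · rw [map_mul, absoluteValue_ringHomTC hw (pow_ne_zero _ X_ne_zero), natDegree_X_pow]
    refine mul_le_mul_of_nonneg_left ?_ (by positivity)
    rw [sub_eq_add_neg]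
    refine (hna _ _).trans (max_le ?_ ?_)
    · rw [map_pow]
      exact pow_le_pow_left₀ (w.nonneg _) (le_max_right _ _) _
    · rw [w.map_neg]
      exact (le_max_right _ _).trans (le_self_pow₀ h1 (by lia))
  · by_cases h0 : c = 0
    · rw [h0, map_zero, map_zero]; positivity
    · rw [absoluteValue_ringHomTC hw h0]
      calc (q : ℝ) ^ c.natDegree ≤ (q : ℝ) ^ E := pow_le_pow_right₀ hq'.le hc
        _ ≤ _ := le_mul_of_one_le_right (by positivity) hm

/-- A lower bound for the value of an Artin–Schreier polynomial at an algebraic element. -/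
theorem one_le_absoluteValue_evalPC_artinSchreier {q : ℕ} (hq : 1 < q)
    {w : AbsoluteValue (AC Fq) ℝ}
    (hna : IsNonarchimedean w) (hw : ∀ x, w (iota Fq x) = absL Fq q x) {E R : ℕ} (hR : 1 < R)
    {c : Polynomial Fq} (hc : c.natDegree ≤ E) {α : AC Fq} {P : Polynomial (Polynomial Fq)}
    (hirr : Irreducible P) (hdeg : 0 < P.natDegree) (hP : evalPC Fq α P = 0)
    (hQ : evalPC Fq α (artinSchreier E R c) ≠ 0) :
    1 ≤ w (evalPC Fq α (artinSchreier E R c)) *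
      (q : ℝ) ^ (E * (P.natDegree - 1) + R * heightExp P) := by
  have hq' : (1 : ℝ) < q := by exact_mod_cast hq
  set Q := artinSchreier E R c with hQdef
  have hinj := ringHomTC_injective (Fq := Fq)
  have hP0 : P ≠ 0 := hirr.ne_zero
  set P' := P.map (ringHomTC Fq) with hP'
  have hP'0 : P' ≠ 0 := (Polynomial.map_ne_zero_iff hinj).2 hP0
  have hnd : P'.natDegree = P.natDegree := natDegree_map_eq_of_injective hinj P
  have hres : ringHomTC Fq (resultant P Q P.natDegree R) =
      P'.leadingCoeff ^ R * (P'.roots.map fun β => evalPC Fq β Q).prod := by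
    rw [← resultant_map_map, ← hP', ← hnd, resultant_eq_prod_eval _ _ _
      (natDegree_map_le.trans (natDegree_artinSchreier hR c).le) (IsAlgClosed.splits P')]
    congr 2
    exact Multiset.map_congr rfl fun β _ => (evalPC_eq_eval_map β Q).symm
  have hne : resultant P Q P.natDegree R ≠ 0 := by
    intro h0
    rw [h0, map_zero] at hres
    rcases mul_eq_zero.1 hres.symm with h | h
    · exact hP'0 (leadingCoeff_eq_zero.1 (pow_eq_zero_iff (by lia) |>.1 h))
    · obtain ⟨β, hβ, h⟩ := Multiset.mem_map.1 (Multiset.prod_eq_zero_iff.1 h)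
      have hPβ : evalPC Fq β P = 0 := by
        rw [evalPC_eq_eval_map]; exact (mem_roots'.1 hβ).2
      obtain ⟨S, hS⟩ := dvd_of_evalPC_eq_zero hirr hdeg hPβ h
      apply hQ
      rw [hS, evalPC, eval₂_mul]
      rw [evalPC] at hP
      rw [hP, zero_mul]
  have hone : 1 ≤ w (ringHomTC Fq (resultant P Q P.natDegree R)) := by
    rw [absoluteValue_ringHomTC hw hne]
    exact one_le_pow₀ hq'.le
  have hα : α ∈ P'.roots := by
    rw [mem_roots hP'0, IsRoot.def, ← evalPC_eq_eval_map, hP]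
  obtain ⟨s, hs⟩ := Multiset.exists_cons_of_mem hα
  have hcard : Multiset.card s = P.natDegree - 1 := by
    have := (splits_iff_card_roots.1 (IsAlgClosed.splits P'))
    rw [hs, Multiset.card_cons, hnd] at this
    lia
  have hprod : ∀ t : Multiset (AC Fq), w (t.map fun β => evalPC Fq β Q).prod ≤
      (q : ℝ) ^ (E * Multiset.card t) * (t.map fun β => max 1 (w β)).prod ^ R := by
    intro t
    induction t using Multiset.induction_on with
    | empty => simp
    | cons b t ih =>
      rw [Multiset.map_cons, Multiset.map_cons, Multiset.prod_cons, Multiset.prod_cons, map_mul,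
        Multiset.card_cons]
      calc _ ≤ _ := mul_le_mul (absoluteValue_evalPC_artinSchreier_le hq hna hw hR hc b) ih
            (w.nonneg _) (by positivity)
        _ = _ := by ring
  have hmahler := leadingCoeff_mul_prod_max_one_le hna P'
  rw [hP', gaussNorm_map_eq hq hw hP0, ← hP', hs, Multiset.map_cons, Multiset.prod_cons] at hmahler
  have hpos : 0 ≤ (s.map fun β => max 1 (w β)).prod := by
    refine Multiset.prod_nonneg fun x hx => ?_
    obtain ⟨b, -, rfl⟩ := Multiset.mem_map.1 hx
    positivity
  have hmahler' : w P'.leadingCoeff * (s.map fun β => max 1 (w β)).prod ≤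
      (q : ℝ) ^ heightExp P := by
    refine le_trans (mul_le_mul_of_nonneg_left ?_ (w.nonneg _)) hmahler
    exact le_mul_of_one_le_left hpos (le_max_left _ _)
  refine hone.trans ?_
  rw [hres, hs, Multiset.map_cons, Multiset.prod_cons, map_mul, map_mul, map_pow]
  calc _ ≤ w P'.leadingCoeff ^ R * (w (evalPC Fq α Q) * ((q : ℝ) ^ (E * Multiset.card s) *
        (s.map fun β => max 1 (w β)).prod ^ R)) := by
        gcongr
        exact hprod s
    _ = w (evalPC Fq α Q) * (q : ℝ) ^ (E * Multiset.card s) *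
        (w P'.leadingCoeff * (s.map fun β => max 1 (w β)).prod) ^ R := by ring
    _ ≤ w (evalPC Fq α Q) * (q : ℝ) ^ (E * Multiset.card s) * ((q : ℝ) ^ heightExp P) ^ R := by
        have := mul_nonneg (w.nonneg P'.leadingCoeff) hpos
        gcongr
    _ = _ := by rw [hcard, pow_add]; ring

/-- Liouville inequality for the distance from an algebraic element to a root of an
Artin–Schreier polynomial. -/
theorem zpow_neg_le_absoluteValue_sub {p : ℕ} [Fact p.Prime] [CharP Fq p] {q : ℕ} (hq : 1 < q)
    {w : AbsoluteValue (AC Fq) ℝ}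
    (hna : IsNonarchimedean w) (hw : ∀ x, w (iota Fq x) = absL Fq q x) {E k : ℕ} (hk : 0 < k)
    {c : Polynomial Fq} (hc : c.natDegree ≤ E) {α γ : AC Fq} {P : Polynomial (Polynomial Fq)}
    (hirr : Irreducible P) (hdeg : 0 < P.natDegree) (hP : evalPC Fq α P = 0)
    (hγ : evalPC Fq γ (artinSchreier E (p ^ k) c) = 0) (hne : α ≠ γ) :
    ((q : ℝ) ^ (E * P.natDegree + p ^ k * heightExp P))⁻¹ ≤ w (γ - α) := by
  have hq' : (1 : ℝ) < q := by exact_mod_cast hq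
  have hR : 1 < p ^ k := Nat.one_lt_pow hk.ne' (Fact.out : p.Prime).one_lt
  by_cases hlt : 1 ≤ w (γ - α)
  · exact (inv_le_one_of_one_le₀ (one_le_pow₀ hq'.le)).trans hlt
  push Not at hlt
  have hchar : CharP (AC Fq) p :=
    charP_of_injective_ringHom ((ringHomTC_injective (Fq := Fq)).comp C_injective) p
      (f := (ringHomTC Fq).comp C)
  have heval : evalPC Fq α (artinSchreier E (p ^ k) c) =
      ringHomTC Fq (X ^ E) * ((γ - α) + - (γ - α) ^ (p ^ k)) := by
    rw [← sub_zero (evalPC Fq α _), ← hγ, evalPC_artinSchreier, evalPC_artinSchreier,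
      sub_pow_char_pow]
    ring
  have hδ : w (γ - α) ≠ 0 := by
    rw [w.ne_zero_iff, sub_ne_zero]; exact hne.symm
  have hδpos : 0 < w (γ - α) := lt_of_le_of_ne (w.nonneg _) hδ.symm
  have hsmall : w (-(γ - α) ^ (p ^ k)) < w (γ - α) := by
    rw [w.map_neg, map_pow]
    exact pow_lt_self_of_lt_one₀ hδpos hlt hR
  have hval : w (evalPC Fq α (artinSchreier E (p ^ k) c)) = (q : ℝ) ^ E * w (γ - α) := by
    rw [heval, map_mul, absoluteValue_ringHomTC hw (pow_ne_zero _ X_ne_zero), natDegree_X_pow]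
    congr 1
    exact IsNonarchimedean.add_eq_left_of_lt hna hsmall
  have hQ : evalPC Fq α (artinSchreier E (p ^ k) c) ≠ 0 := by
    rw [← w.ne_zero_iff, hval]; positivity
  have h := one_le_absoluteValue_evalPC_artinSchreier hq hna hw hR hc hirr hdeg hP hQ
  rw [hval] at h
  rw [inv_le_iff_one_le_mul₀ (by positivity)]
  refine h.trans (le_of_eq ?_)
  obtain ⟨d, hd⟩ : ∃ d, P.natDegree = d + 1 := ⟨P.natDegree - 1, by lia⟩
  rw [hd, Nat.add_sub_cancel]
  ring

/-- The lacunary power series `∑_{e ≥ 1} g e u^{r^e}`. -/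
def lacunary (r : ℕ) (g : ℕ → Fq) : PowerSeries Fq :=
  PowerSeries.mk fun k => if k = r ^ Nat.log r k ∧ 1 ≤ Nat.log r k then g (Nat.log r k) else 0

theorem coeff_lacunary_pow {r : ℕ} (hr : 1 < r) (g : ℕ → Fq) {e : ℕ} (he : 1 ≤ e) :
    (lacunary r g).coeff (r ^ e) = g e := by
  rw [lacunary, PowerSeries.coeff_mk, Nat.log_pow hr, if_pos ⟨rfl, he⟩]

theorem coeff_lacunary_of_ne {r : ℕ} (g : ℕ → Fq) {k : ℕ} (hk : ∀ e, 1 ≤ e → k ≠ r ^ e) :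
    (lacunary r g).coeff k = 0 := by
  rw [lacunary, PowerSeries.coeff_mk, if_neg]
  rintro ⟨h, h1⟩
  exact hk _ h1 h

theorem lacunary_ext {r : ℕ} {f : PowerSeries Fq} (g : ℕ → Fq) (hr : 1 < r)
    (h1 : ∀ e, 1 ≤ e → f.coeff (r ^ e) = g e)
    (h0 : ∀ k, (∀ e, 1 ≤ e → k ≠ r ^ e) → f.coeff k = 0) : f = lacunary r g := by
  ext k
  by_cases hk : ∃ e, 1 ≤ e ∧ k = r ^ e
  · obtain ⟨e, he, rfl⟩ := hk
    rw [h1 e he, coeff_lacunary_pow hr g he]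
  · push Not at hk
    rw [h0 k hk, coeff_lacunary_of_ne g hk]

theorem lacunary_sub {r : ℕ} (hr : 1 < r) (g h : ℕ → Fq) :
    lacunary r g - lacunary r h = lacunary r (g - h) := by
  refine lacunary_ext _ hr (fun e he => ?_) fun k hk => ?_
  · rw [map_sub, coeff_lacunary_pow hr _ he, coeff_lacunary_pow hr _ he, Pi.sub_apply]
  · rw [map_sub, coeff_lacunary_of_ne _ hk, coeff_lacunary_of_ne _ hk, sub_zero]

theorem coeff_pow_char_pow {p : ℕ} [Fact p.Prime] [CharP Fq p] (f : PowerSeries Fq) (k n : ℕ) :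
    (f ^ p ^ k).coeff n = if p ^ k ∣ n then f.coeff (n / p ^ k) ^ p ^ k else 0 := by
  have hp : p ≠ 0 := (Fact.out : p.Prime).ne_zero
  have h : (f.expand (p ^ k) (pow_ne_zero k hp)).map (iterateFrobenius Fq p k) = f ^ p ^ k :=
    MvPowerSeries.map_iterateFrobenius_expand p hp f k
  rw [← h, PowerSeries.coeff_map, PowerSeries.coeff_expand]
  split_ifs
  · rw [iterateFrobenius_def]
  · rw [map_zero]

theorem lacunary_pow_char_pow {p : ℕ} [Fact p.Prime] [CharP Fq p] {r l : ℕ} (hr : 1 < r)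
    (hl : r = p ^ l) (g : ℕ → Fq) (hg : ∀ e, ∃ a : ℕ, g e = a) (M : ℕ) :
    lacunary r g ^ r ^ M = lacunary r fun e => if M < e then g (e - M) else 0 := by
  have hfrob : ∀ e, g e ^ r ^ M = g e := by
    intro e
    obtain ⟨a, ha⟩ := hg e
    rw [ha, hl, ← pow_mul, ← iterateFrobenius_def, map_natCast]
  have hcoeff : ∀ n, (lacunary r g ^ r ^ M).coeff n =
      if r ^ M ∣ n then (lacunary r g).coeff (n / r ^ M) ^ r ^ M else 0 := by
    intro n
    have := coeff_pow_char_pow (p := p) (lacunary r g) (l * M) n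
    rwa [pow_mul, ← hl] at this
  have hrM : 0 < r ^ M := by positivity
  refine lacunary_ext _ hr (fun e he => ?_) fun k hk => ?_
  · rw [hcoeff]
    rcases lt_trichotomy M e with h | h | h
    · rw [if_pos (pow_dvd_pow r h.le), if_pos h, Nat.pow_div h.le (by lia),
        coeff_lacunary_pow hr g (by lia), hfrob]
    · subst h
      rw [if_pos dvd_rfl, if_neg (lt_irrefl _), Nat.div_self hrM, coeff_lacunary_of_ne,
        zero_pow hrM.ne']
      intro e he h
      exact absurd h.symm (Nat.one_lt_pow (by lia) hr).ne'
    · rw [if_neg, if_neg (by lia)]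
      rw [Nat.pow_dvd_pow_iff_le_right hr]
      lia
  · rw [hcoeff]
    split_ifs with hd
    · obtain ⟨n, rfl⟩ := hd
      rw [Nat.mul_div_cancel_left _ hrM, coeff_lacunary_of_ne, zero_pow hrM.ne']
      rintro e he rfl
      exact hk (M + e) (by lia) (pow_add r M e).symm
    · rfl

/-- A polynomial in `T⁻¹` of degree at most `E` becomes a polynomial in `T` after
multiplication by `T^E`. -/
theorem exists_ringHomT_eq (f : PowerSeries Fq) (E : ℕ) (hf : ∀ k, E < k → f.coeff k = 0) :
    ∃ c : Polynomial Fq, c.natDegree ≤ E ∧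
      ringHomT Fq c = Tel Fq ^ E * HahnSeries.ofPowerSeries ℤ Fq f := by
  refine ⟨∑ k ∈ Finset.range (E + 1), monomial k (f.coeff (E - k)), ?_, ?_⟩
  · refine natDegree_sum_le_of_forall_le _ _ fun k hk => ?_
    exact (natDegree_monomial_le _).trans (by rw [Finset.mem_range] at hk; lia)
  · ext n
    rw [coeff_ringHomT, Tel_pow, HahnSeries.coeff_single_mul, one_mul, finsetSum_coeff]
    simp only [coeff_monomial]
    rw [Finset.sum_ite_eq']
    rw [PowerSeries.coeff_coe]
    by_cases hn : n ≤ 0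
    · rw [if_pos hn]
      by_cases hE : n.natAbs ∈ Finset.range (E + 1)
      · rw [Finset.mem_range] at hE
        rw [if_pos (by simpa using hE), if_neg (by lia)]
        congr 2
        lia
      · rw [Finset.mem_range] at hE
        rw [if_neg (by simpa using hE), if_pos (by lia)]
    · rw [if_neg hn, if_neg (by lia), hf]
      lia

/-- A lacunary series with eventually periodic coefficients in the prime field is a root of an
Artin–Schreier polynomial. -/
theorem exists_artinSchreier_root {p : ℕ} [Fact p.Prime] [CharP Fq p] {r l : ℕ} (hr : 1 < r)
    (hl : r = p ^ l) (g : ℕ → Fq) (hg : ∀ e, ∃ a : ℕ, g e = a) (M L : ℕ)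
    (hper : ∀ e, L < e → g (e + M) = g e) :
    ∃ c : Polynomial Fq, c.natDegree ≤ r ^ (L + M) ∧
      evalPC Fq (iota Fq (HahnSeries.ofPowerSeries ℤ Fq (lacunary r g)))
        (artinSchreier (r ^ (L + M)) (r ^ M) c) = 0 := by
  have hpow := lacunary_pow_char_pow hr hl g hg M
  obtain ⟨c, hc, hcT⟩ := exists_ringHomT_eq (lacunary r g - lacunary r g ^ r ^ M) (r ^ (L + M)) <| by
    intro k hk
    rw [hpow, lacunary_sub hr]
    by_cases h : ∃ e, 1 ≤ e ∧ k = r ^ e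
    · obtain ⟨e, he, rfl⟩ := h
      have hlt : L + M < e := (Nat.pow_lt_pow_iff_right hr).1 hk
      rw [coeff_lacunary_pow hr _ he, Pi.sub_apply, if_pos (by lia),
        ← hper (e - M) (by lia), Nat.sub_add_cancel (by lia), sub_self]
    · push Not at h
      exact coeff_lacunary_of_ne _ h
  refine ⟨c, hc, ?_⟩
  rw [evalPC_artinSchreier, ringHomTC, RingHom.comp_apply, RingHom.comp_apply, hcT, ← map_pow,
    ← map_sub, ← map_mul, ← map_add]
  have hX : ringHomT Fq (X ^ r ^ (L + M)) = Tel Fq ^ r ^ (L + M) := by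
    rw [map_pow, ringHomT, coe_eval₂RingHom, eval₂_X]
  rw [hX, map_sub (HahnSeries.ofPowerSeries ℤ Fq), map_pow]
  convert map_zero (iota Fq) using 2
  ring

theorem coeff_ofPowerSeries_of_lt {f : PowerSeries Fq} {n : ℕ} (h : ∀ k < n, f.coeff k = 0) :
    ∀ k : ℤ, k < n → (HahnSeries.ofPowerSeries ℤ Fq f).coeff k = 0 := by
  intro k hk
  rw [PowerSeries.coeff_coe]
  split_ifs
  · rfl
  · exact h _ (by lia)

theorem coeff_lacunary_of_lt {r : ℕ} (hr : 1 < r) {f : ℕ → Fq} {e₀ : ℕ}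
    (hf : ∀ e, 1 ≤ e → e < e₀ → f e = 0) : ∀ k < r ^ e₀, (lacunary r f).coeff k = 0 := by
  intro k hk
  by_cases h : ∃ e, 1 ≤ e ∧ k = r ^ e
  · obtain ⟨e, he, rfl⟩ := h
    rw [coeff_lacunary_pow hr _ he, hf e he ((Nat.pow_lt_pow_iff_right hr).1 hk)]
  · push Not at h
    exact coeff_lacunary_of_ne _ h

theorem absL_lacunary_le {q : ℕ} (hq : 1 < q) {r : ℕ} (hr : 1 < r) {f : ℕ → Fq} {e₀ : ℕ}
    (hf : ∀ e, 1 ≤ e → e < e₀ → f e = 0) :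
    absL Fq q (HahnSeries.ofPowerSeries ℤ Fq (lacunary r f)) ≤ ((q : ℝ) ^ r ^ e₀)⁻¹ := by
  rw [← zpow_natCast, ← zpow_neg, absL_le_zpow_iff hq]
  exact coeff_ofPowerSeries_of_lt (coeff_lacunary_of_lt hr hf)

theorem absL_lacunary_eq {q : ℕ} {r : ℕ} (hr : 1 < r) {f : ℕ → Fq} {e₀ : ℕ}
    (he₀ : 1 ≤ e₀) (hf : ∀ e, 1 ≤ e → e < e₀ → f e = 0) (hf₀ : f e₀ ≠ 0) :
    absL Fq q (HahnSeries.ofPowerSeries ℤ Fq (lacunary r f)) = ((q : ℝ) ^ r ^ e₀)⁻¹ := by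
  rw [← zpow_natCast, ← zpow_neg]
  refine absL_eq_zpow _ _ (coeff_ofPowerSeries_of_lt (coeff_lacunary_of_lt hr hf)) ?_
  rw [PowerSeries.coeff_coe, if_neg (by lia), Int.natAbs_natCast, coeff_lacunary_pow hr _ he₀]
  exact hf₀

/-- The partial products `m_0 m_1 ⋯ m_j`. -/
def partialProd (m : ℕ → ℕ) (j : ℕ) : ℕ := ∏ i ∈ Finset.range (j + 1), m i

theorem partialProd_succ (m : ℕ → ℕ) (j : ℕ) :
    partialProd m (j + 1) = partialProd m j * m (j + 1) :=
  Finset.prod_range_succ _ _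

theorem partialProd_dvd (m : ℕ → ℕ) {i j : ℕ} (h : i ≤ j) : partialProd m i ∣ partialProd m j :=
  Finset.prod_dvd_prod_of_subset _ _ _ (Finset.range_mono (by lia))

theorem lt_partialProd {m : ℕ → ℕ} (hm0 : m 0 = 1) (hm : ∀ j, 1 ≤ j → 2 ≤ m j) (j : ℕ) :
    j < partialProd m j := by
  induction j with
  | zero => simp [partialProd, hm0]
  | succ j ih =>
    rw [partialProd_succ]
    nlinarith [hm (j + 1) (by lia)]

theorem rr_eq (r : ℕ) (m : ℕ → ℕ) (j : ℕ) : rr r m j = r ^ partialProd m j := rfl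

/-- The indices `i` with `m_0 ⋯ m_i ∣ e`. -/
def divIndices (m : ℕ → ℕ) (e : ℕ) : Finset ℕ := (Finset.range e).filter (partialProd m · ∣ e)

theorem mem_divIndices {m : ℕ → ℕ} (hm0 : m 0 = 1) (hm : ∀ j, 1 ≤ j → 2 ≤ m j) {e i : ℕ}
    (he : 1 ≤ e) : i ∈ divIndices m e ↔ partialProd m i ∣ e := by
  rw [divIndices, Finset.mem_filter, Finset.mem_range, and_iff_right_iff_imp]
  intro h
  exact (lt_partialProd hm0 hm i).trans_le (Nat.le_of_dvd he h)

theorem xi_eq_lacunary {r : ℕ} (hr : 1 < r) {m : ℕ → ℕ} (hm0 : m 0 = 1)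
    (hm : ∀ j, 1 ≤ j → 2 ≤ m j) :
    xi Fq r m = HahnSeries.ofPowerSeries ℤ Fq
      (lacunary r fun e => ((divIndices m e).card : Fq)) := by
  rw [xi, xiA]
  congr 1
  refine lacunary_ext _ hr (fun e he => ?_) fun k hk => ?_
  · have key : ∀ j, (∃ n : ℕ, 1 ≤ n ∧ r ^ e = rr r m j ^ n) ↔ j ∈ divIndices m e := by
      intro j
      rw [mem_divIndices hm0 hm he]
      constructor
      · rintro ⟨n, hn, h⟩
        rw [rr_eq, ← pow_mul] at h
        exact ⟨n, Nat.pow_right_injective hr h⟩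
      · rintro ⟨n, rfl⟩
        refine ⟨n, Nat.pos_of_ne_zero ?_, by rw [rr_eq, ← pow_mul]⟩
        rintro rfl
        simp at he
    simp only [PowerSeries.coeff_mk, Nat.cast_one, one_mul, key]
    rw [finsum_eq_sum_of_support_subset (s := divIndices m e)]
    · simp
    · intro j hj
      by_contra h
      exact hj (if_neg h)
  · rw [PowerSeries.coeff_mk]
    refine (finsum_congr fun j => ?_).trans finsum_zero
    rw [if_neg, mul_zero]
    rintro ⟨n, hn, h⟩
    rw [rr_eq, ← pow_mul] at h
    exact hk _ (Nat.mul_pos ((Nat.zero_le j).trans_lt (lt_partialProd hm0 hm j)) hn) h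

/-- The indices in `divIndices m e` that are greater than `j`. -/
def tailIndices (m : ℕ → ℕ) (j e : ℕ) : Finset ℕ := (divIndices m e).filter (j < ·)

theorem tailIndices_eq {m : ℕ → ℕ} (hm0 : m 0 = 1) (hm : ∀ j, 1 ≤ j → 2 ≤ m j) {j l e : ℕ}
    (he : 1 ≤ e) (h : partialProd m (j + l) ∣ e) (h' : ¬ partialProd m (j + l + 1) ∣ e) :
    tailIndices m j e = Finset.Ioc j (j + l) := by
  ext i
  rw [tailIndices, Finset.mem_filter, mem_divIndices hm0 hm he, Finset.mem_Ioc, and_comm,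
    and_congr_right_iff]
  intro _
  refine ⟨fun hi => ?_, fun hi => (partialProd_dvd m hi).trans h⟩
  by_contra hlt
  exact h' ((partialProd_dvd m (by lia)).trans hi)

theorem tailIndices_eq_empty {m : ℕ → ℕ} (hm0 : m 0 = 1) (hm : ∀ j, 1 ≤ j → 2 ≤ m j) {j e : ℕ}
    (he : 1 ≤ e) (h' : ¬ partialProd m (j + 1) ∣ e) : tailIndices m j e = ∅ := by
  rw [Finset.eq_empty_iff_forall_notMem]
  intro i hi
  rw [tailIndices, Finset.mem_filter, mem_divIndices hm0 hm he] at hi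
  exact h' ((partialProd_dvd m (by lia)).trans hi.1)

theorem card_divIndices (m : ℕ → ℕ) (j e : ℕ) :
    (divIndices m e).card =
      ((divIndices m e).filter (· ≤ j)).card + (tailIndices m j e).card := by
  rw [tailIndices, ← Finset.card_filter_add_card_filter_not (p := (· ≤ j))]
  simp only [not_le]

/-- The coefficients of the approximant `γ_{j,N}` of `ξ`: those of `ξ` up to `M_{j+1} N`, and those
of `α_0 + ⋯ + α_j` afterwards. -/
def approxCoeff (Fq : Type) [Field Fq] (m : ℕ → ℕ) (j N e : ℕ) : Fq :=
  if e ≤ partialProd m (j + 1) * N then ((divIndices m e).card : Fq)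
  else (((divIndices m e).filter (· ≤ j)).card : Fq)

/-- An algebraic approximant of `ξ`. -/
def approx (Fq : Type) [Field Fq] (r : ℕ) (m : ℕ → ℕ) (j N : ℕ) : LaurentSeries Fq :=
  HahnSeries.ofPowerSeries ℤ Fq (lacunary r (approxCoeff Fq m j N))

theorem approxCoeff_eq_natCast (m : ℕ → ℕ) (j N e : ℕ) :
    ∃ a : ℕ, approxCoeff Fq m j N e = a := by
  rw [approxCoeff]
  split_ifs
  exacts [⟨_, rfl⟩, ⟨_, rfl⟩]

theorem approxCoeff_add {m : ℕ → ℕ} (hm0 : m 0 = 1) (hm : ∀ j, 1 ≤ j → 2 ≤ m j) {j N e : ℕ}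
    (he : partialProd m (j + 1) * N < e) :
    approxCoeff Fq m j N (e + partialProd m j) = approxCoeff Fq m j N e := by
  rw [approxCoeff, approxCoeff, if_neg (by lia), if_neg (by lia)]
  congr 2
  ext i
  rw [Finset.mem_filter, Finset.mem_filter, mem_divIndices hm0 hm (by lia),
    mem_divIndices hm0 hm (by lia)]
  refine and_congr_left fun hi => ?_
  exact (Nat.dvd_add_iff_left (partialProd_dvd m hi)).symm

theorem sub_approxCoeff (m : ℕ → ℕ) (j N e : ℕ) :
    ((divIndices m e).card : Fq) - approxCoeff Fq m j N e =
      if e ≤ partialProd m (j + 1) * N then 0 else ((tailIndices m j e).card : Fq) := by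
  rw [approxCoeff]
  split_ifs
  · rw [sub_self]
  · rw [card_divIndices m j, Nat.cast_add, add_sub_cancel_left]

theorem exists_artinSchreier_approx {p : ℕ} [Fact p.Prime] [CharP Fq p] {r l : ℕ} (hr : 1 < r)
    (hl : r = p ^ l) {m : ℕ → ℕ} (hm0 : m 0 = 1) (hm : ∀ j, 1 ≤ j → 2 ≤ m j) (j N : ℕ) :
    ∃ c : Polynomial Fq, c.natDegree ≤ rr r m j * rr r m (j + 1) ^ N ∧
      evalPC Fq (iota Fq (approx Fq r m j N))
        (artinSchreier (rr r m j * rr r m (j + 1) ^ N) (rr r m j) c) = 0 := by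
  have h := exists_artinSchreier_root hr hl (approxCoeff Fq m j N) (approxCoeff_eq_natCast m j N)
    (partialProd m j) (partialProd m (j + 1) * N) fun e he => approxCoeff_add hm0 hm he
  rwa [pow_add, mul_comm, pow_mul] at h

theorem xi_sub_approx {r : ℕ} (hr : 1 < r) {m : ℕ → ℕ} (hm0 : m 0 = 1)
    (hm : ∀ j, 1 ≤ j → 2 ≤ m j) (j N : ℕ) :
    xi Fq r m - approx Fq r m j N = HahnSeries.ofPowerSeries ℤ Fq (lacunary r fun e =>
      if e ≤ partialProd m (j + 1) * N then 0 else ((tailIndices m j e).card : Fq)) := by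
  rw [xi_eq_lacunary hr hm0 hm, approx, ← map_sub, lacunary_sub hr]
  congr 2
  ext e
  exact sub_approxCoeff m j N e

/-- `|ξ - γ_{j,N}| ≤ q^{-r_{j+1}^{N+1}}`. -/
theorem absL_xi_sub_approx_le {q : ℕ} (hq : 1 < q) {r : ℕ} (hr : 1 < r) {m : ℕ → ℕ}
    (hm0 : m 0 = 1) (hm : ∀ j, 1 ≤ j → 2 ≤ m j) (j N : ℕ) :
    absL Fq q (xi Fq r m - approx Fq r m j N) ≤ ((q : ℝ) ^ rr r m (j + 1) ^ (N + 1))⁻¹ := by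
  rw [xi_sub_approx hr hm0 hm, rr_eq, ← pow_mul]
  refine absL_lacunary_le hq hr fun e he h => ?_
  split_ifs with hN
  · rfl
  rw [tailIndices_eq_empty hm0 hm he, Finset.card_empty, Nat.cast_zero]
  rintro ⟨s, rfl⟩
  rw [not_le] at hN
  exact absurd (lt_of_mul_lt_mul_left' hN) (by have := lt_of_mul_lt_mul_left' h; lia)

theorem approx_ne_approx_add_two {r : ℕ} (hr : 1 < r) {m : ℕ → ℕ}
    (hm0 : m 0 = 1) (hm : ∀ j, 1 ≤ j → 2 ≤ m j) (j N : ℕ) :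
    approx Fq r m j N ≠ approx Fq r m j (N + 2) := by
  have hM : 0 < partialProd m (j + 1) := (Nat.zero_le _).trans_lt (lt_partialProd hm0 hm _)
  obtain ⟨s, hs, hsN, hd⟩ : ∃ s, N < s ∧ s ≤ N + 2 ∧ ¬ m (j + 2) ∣ s := by
    by_contra! h
    have h1 := (Nat.dvd_add_right (h (N + 1) (by lia) (by lia))).1 (h (N + 1 + 1) (by lia) (by lia))
    have := hm (j + 2) (by lia)
    exact absurd (Nat.le_of_dvd one_pos h1) (by lia)
  have he : 1 ≤ partialProd m (j + 1) * s := Nat.mul_pos hM (by lia)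
  intro heq
  have h : lacunary r (approxCoeff Fq m j N) = lacunary r (approxCoeff Fq m j (N + 2)) :=
    HahnSeries.ofPowerSeries_injective heq
  have h2 := congrArg (PowerSeries.coeff (r ^ (partialProd m (j + 1) * s))) h
  rw [coeff_lacunary_pow hr _ he, coeff_lacunary_pow hr _ he] at h2
  have h3 := sub_approxCoeff (Fq := Fq) m j N (partialProd m (j + 1) * s)
  rw [h2, sub_approxCoeff, if_pos (Nat.mul_le_mul_left _ hsN),
    if_neg (not_le.2 (Nat.mul_lt_mul_of_pos_left hs hM)),
    tailIndices_eq hm0 hm (l := 1) he (Dvd.intro _ rfl)] at h3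
  · simp at h3
  · rw [partialProd_succ]
    exact fun h => hd (Nat.dvd_of_mul_dvd_mul_left hM h)

/-- For infinitely many `N`, the approximation of `ξ` by `γ_{j,N}` is exceptionally good, because
`p` consecutive terms of the sum defining `ξ` cancel. -/
theorem exists_absL_xi_sub_approx_eq {p : ℕ} [Fact p.Prime] [CharP Fq p] {q r : ℕ} (hr : 1 < r)
    {m : ℕ → ℕ} (hm0 : m 0 = 1) (hm : ∀ j, 1 ≤ j → 2 ≤ m j) (j K : ℕ) :
    ∃ N ≥ K, absL Fq q (xi Fq r m - approx Fq r m j N) =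
      ((q : ℝ) ^ rr r m (j + 1) ^ (N + 2))⁻¹ := by
  have hp : 2 ≤ p := (Fact.out : p.Prime).two_le
  have hM : ∀ i, 0 < partialProd m i := fun i => (Nat.zero_le _).trans_lt (lt_partialProd hm0 hm _)
  obtain ⟨A, hA⟩ := partialProd_dvd m (show j + 2 ≤ j + p by lia)
  have hA0 : 0 < A := Nat.pos_of_mul_pos_left (a := partialProd m (j + 2)) (by rw [← hA]; exact hM _)
  have hm2 := hm (j + 2) (by lia)
  have hmp := hm (j + p + 1) (by lia)
  set s := m (j + 2) * A * (1 + m (j + p + 1) * K) with hs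
  have hsK : K < s := by
    have h1 : 2 * 1 ≤ m (j + 2) * A := Nat.mul_le_mul hm2 hA0
    have h2 := Nat.mul_le_mul h1 (le_refl (1 + m (j + p + 1) * K))
    have h3 := Nat.mul_le_mul hmp (le_refl K)
    rw [hs]
    lia
  have hMs : partialProd m (j + 1) * s = partialProd m (j + p) * (1 + m (j + p + 1) * K) := by
    rw [hA, show partialProd m (j + 2) = _ from partialProd_succ m (j + 1), hs]
    ring
  have hs1 : 1 ≤ partialProd m (j + 1) * s := Nat.mul_pos (hM _) (by lia)
  refine ⟨s - 1, by lia, ?_⟩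
  have hcs : (tailIndices m j (partialProd m (j + 1) * s)).card = p := by
    rw [tailIndices_eq hm0 hm (l := p) hs1]
    · simp
    · exact ⟨_, hMs⟩
    · rw [hMs, partialProd_succ]
      intro h
      have h1 := Nat.dvd_of_mul_dvd_mul_left (hM _) h
      have h2 := (Nat.dvd_add_left (Dvd.intro _ rfl)).1 h1
      exact absurd (Nat.le_of_dvd one_pos h2) (by lia)
  have hcs1 : (tailIndices m j (partialProd m (j + 1) * (s + 1))).card = 1 := by
    rw [tailIndices_eq hm0 hm (l := 1) (Nat.mul_pos (hM _) (by lia)) (Dvd.intro _ rfl)]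
    · simp
    · rw [partialProd_succ]
      intro h
      have h1 := Nat.dvd_of_mul_dvd_mul_left (hM _) h
      have h2 := (Nat.dvd_add_right (hs ▸ mul_assoc (m (j + 2)) A _ ▸ Dvd.intro _ rfl)).1 h1
      exact absurd (Nat.le_of_dvd one_pos h2) (by lia)
  rw [xi_sub_approx hr hm0 hm, rr_eq, ← pow_mul, show s - 1 + 2 = s + 1 by lia]
  refine absL_lacunary_eq hr (Nat.mul_pos (hM _) (by lia)) (fun e he h => ?_) ?_
  · split_ifs with hN
    · rfl
    by_cases hd : partialProd m (j + 1) ∣ e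
    · obtain ⟨t, rfl⟩ := hd
      rw [not_le] at hN
      have h1 := lt_of_mul_lt_mul_left' hN
      have h2 := lt_of_mul_lt_mul_left' h
      rw [show t = s by lia, hcs, CharP.cast_eq_zero]
    · rw [tailIndices_eq_empty hm0 hm he hd, Finset.card_empty, Nat.cast_zero]
  · rw [if_neg (not_le.2 (Nat.mul_lt_mul_of_pos_left (by lia) (hM _))), hcs1, Nat.cast_one]
    exact one_ne_zero

theorem exists_isMinPolyOf {α : AC Fq} {Q : Polynomial (Polynomial Fq)} (hQ : Q ≠ 0)
    (hα : evalPC Fq α Q = 0) : ∃ P, IsMinPolyOf Fq α P := by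
  obtain ⟨f, hf, hfQ⟩ := UniqueFactorizationMonoid.exists_prime_factors Q hQ
  obtain ⟨P, hPf, hP⟩ : ∃ P ∈ f, evalPC Fq α P = 0 := by
    obtain ⟨u, hu⟩ := hfQ.symm
    have h : eval₂RingHom (ringHomTC Fq) α f.prod = 0 := by
      rw [← hu, map_mul, show eval₂RingHom (ringHomTC Fq) α Q = 0 from hα, zero_mul]
    rw [map_multiset_prod, Multiset.prod_eq_zero_iff, Multiset.mem_map] at h
    exact h
  have hirr := (hf P hPf).irreducible
  have hdeg : 0 < P.natDegree := by
    by_contra h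
    rw [eq_C_of_natDegree_eq_zero (by lia : P.natDegree = 0), evalPC, eval₂_C] at hP
    have h0 := ringHomTC_injective (hP.trans (map_zero _).symm)
    apply hirr.ne_zero
    rw [eq_C_of_natDegree_eq_zero (by lia : P.natDegree = 0), h0, C_0]
  have ha : P.leadingCoeff.leadingCoeff ≠ 0 :=
    leadingCoeff_ne_zero.2 (leadingCoeff_ne_zero.2 hirr.ne_zero)
  have hu : IsUnit (C (C P.leadingCoeff.leadingCoeff⁻¹) : Polynomial (Polynomial Fq)) :=
    ((isUnit_iff_ne_zero.2 (inv_ne_zero ha)).map C).map C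
  have hirr' := (irreducible_isUnit_mul hu).2 hirr
  have hdeg' : (C (C P.leadingCoeff.leadingCoeff⁻¹) * P).natDegree = P.natDegree :=
    natDegree_C_mul (C_ne_zero.2 (inv_ne_zero ha))
  refine ⟨C (C P.leadingCoeff.leadingCoeff⁻¹) * P, hdeg'.symm ▸ hdeg, hirr',
    hirr'.isPrimitive (hdeg'.symm ▸ hdeg).ne', ?_, ?_⟩
  · rw [leadingCoeff_mul, leadingCoeff_C, Monic, leadingCoeff_mul, leadingCoeff_C,
      inv_mul_cancel₀ ha]
  · rw [evalPC, eval₂_mul, show eval₂ (ringHomTC Fq) α P = 0 from hP, mul_zero]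

theorem IsAlgT.exists_isMinPolyOf_degT_heightT {α : AC Fq} (h : IsAlgT Fq α) (q : ℕ) :
    ∃ P, IsMinPolyOf Fq α P ∧ degT Fq α = P.natDegree ∧
      heightT Fq q α = (q : ℝ) ^ heightExp P := by
  refine ⟨h.choose, h.choose_spec, ?_, ?_⟩
  · rw [degT, dif_pos h]
  · rw [heightT, dif_pos h, heightP_eq q h.choose_spec.2.1.ne_zero]

theorem rr_pos {r : ℕ} (hr : 1 < r) (m : ℕ → ℕ) (j : ℕ) : 0 < rr r m j :=
  Nat.pow_pos (by lia)

theorem one_lt_rr {r : ℕ} (hr : 1 < r) {m : ℕ → ℕ} (hm0 : m 0 = 1)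
    (hm : ∀ j, 1 ≤ j → 2 ≤ m j) (j : ℕ) : 1 < rr r m j :=
  Nat.one_lt_pow (by have := lt_partialProd hm0 hm j; rw [partialProd] at this; lia) hr

theorem rr_succ (r : ℕ) (m : ℕ → ℕ) (j : ℕ) : rr r m (j + 1) = rr r m j ^ m (j + 1) := by
  rw [rr_eq, rr_eq, partialProd_succ, pow_mul]

theorem isAlgT_approx {p : ℕ} [Fact p.Prime] [CharP Fq p] {r l : ℕ} (hr : 1 < r)
    (hl : r = p ^ l) {m : ℕ → ℕ} (hm0 : m 0 = 1) (hm : ∀ j, 1 ≤ j → 2 ≤ m j) (j N : ℕ) :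
    IsAlgT Fq (iota Fq (approx Fq r m j N)) := by
  obtain ⟨c, _, hroot⟩ := exists_artinSchreier_approx (Fq := Fq) hr hl hm0 hm j N
  exact exists_isMinPolyOf (artinSchreier_ne_zero (one_lt_rr hr hm0 hm j) c) hroot

theorem degT_approx_le {p : ℕ} [Fact p.Prime] [CharP Fq p] {r l : ℕ} (hr : 1 < r)
    (hl : r = p ^ l) {m : ℕ → ℕ} (hm0 : m 0 = 1) (hm : ∀ j, 1 ≤ j → 2 ≤ m j) (j N : ℕ) :
    degT Fq (iota Fq (approx Fq r m j N)) ≤ rr r m j := by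
  obtain ⟨c, _, hroot⟩ := exists_artinSchreier_approx (Fq := Fq) hr hl hm0 hm j N
  obtain ⟨P, hP, hd, _⟩ :=
    (isAlgT_approx (Fq := Fq) hr hl hm0 hm j N).exists_isMinPolyOf_degT_heightT 0
  have hR := one_lt_rr hr hm0 hm j
  rw [hd, ← natDegree_artinSchreier (E := rr r m j * rr r m (j + 1) ^ N) hR c]
  exact natDegree_le_of_dvd (dvd_of_evalPC_eq_zero hP.2.1 hP.1 hP.2.2.2.2 hroot)
    (artinSchreier_ne_zero hR c)

theorem heightT_approx_le {p : ℕ} [Fact p.Prime] [CharP Fq p] {q : ℕ} (hq : 1 < q) {r l : ℕ}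
    (hr : 1 < r) (hl : r = p ^ l) {m : ℕ → ℕ} (hm0 : m 0 = 1) (hm : ∀ j, 1 ≤ j → 2 ≤ m j)
    (j N : ℕ) :
    0 < heightT Fq q (iota Fq (approx Fq r m j N)) ∧
      heightT Fq q (iota Fq (approx Fq r m j N)) ≤ (q : ℝ) ^ (rr r m j * rr r m (j + 1) ^ N) := by
  obtain ⟨c, hc, hroot⟩ := exists_artinSchreier_approx (Fq := Fq) hr hl hm0 hm j N
  obtain ⟨P, hP, _, hh⟩ :=
    (isAlgT_approx (Fq := Fq) hr hl hm0 hm j N).exists_isMinPolyOf_degT_heightT q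
  obtain ⟨w, hna, hw, _⟩ := exists_absC_absoluteValue Fq hq
  have hR := one_lt_rr hr hm0 hm j
  have hq' : (1 : ℝ) < q := by exact_mod_cast hq
  rw [hh]
  refine ⟨by positivity, pow_le_pow_right₀ hq'.le ?_⟩
  obtain ⟨Q, hQ⟩ := dvd_of_evalPC_eq_zero hP.2.1 hP.1 hP.2.2.2.2 hroot
  have hne := artinSchreier_ne_zero (E := rr r m j * rr r m (j + 1) ^ N) hR c
  have h := heightExp_artinSchreier_le (R := rr r m j) hc
  rw [hQ, heightExp_mul hq hna hw (left_ne_zero_of_mul (hQ ▸ hne))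
    (right_ne_zero_of_mul (hQ ▸ hne))] at h
  lia

theorem absC_iota_sub_iota {q : ℕ} (hq : 1 < q) (x y : LaurentSeries Fq) :
    absC Fq q (iota Fq x - iota Fq y) = absL Fq q (x - y) := by
  obtain ⟨w, _, hw, hwC⟩ := exists_absC_absoluteValue Fq hq
  rw [← hwC, ← map_sub, hw]

/-- The lower bound `w_n^*(ξ) ≥ r_{j+1}^2 / r_j - 1` for `n ≥ r_j`. -/
theorem le_wnStar {p : ℕ} [Fact p.Prime] [CharP Fq p] {q : ℕ} (hq : 1 < q) {r l : ℕ}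
    (hr : 1 < r) (hl : r = p ^ l) {m : ℕ → ℕ} (hm0 : m 0 = 1) (hm : ∀ j, 1 ≤ j → 2 ≤ m j)
    {j n : ℕ} (hn : rr r m j ≤ n) :
    (((rr r m (j + 1) : ℝ) ^ 2 / rr r m j - 1 : ℝ) : EReal) ≤ wnStar Fq q n (xi Fq r m) := by
  have hq' : (1 : ℝ) < q := by exact_mod_cast hq
  have hR := one_lt_rr hr hm0 hm j
  have hS := one_lt_rr hr hm0 hm (j + 1)
  refine le_sSup (mem_image_of_mem _ ?_)
  have hI : {N : ℕ | absL Fq q (xi Fq r m - approx Fq r m j N) =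
      ((q : ℝ) ^ rr r m (j + 1) ^ (N + 2))⁻¹}.Infinite := by
    refine Set.infinite_of_forall_exists_gt fun K => ?_
    obtain ⟨N, hN, h⟩ := exists_absL_xi_sub_approx_eq (Fq := Fq) (p := p) (q := q) hr hm0 hm j (K + 1)
    exact ⟨N, h, by lia⟩
  refine (hI.image (f := fun N => iota Fq (approx Fq r m j N)) ?_).mono ?_
  · intro N hN N' hN' h
    have h' : approx Fq r m j N = approx Fq r m j N' := (iota Fq).injective h
    rw [mem_ofPred_eq] at hN hN'
    rw [h', hN', inv_inj] at hN
    have h1 := Nat.pow_right_injective hq (by exact_mod_cast hN)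
    have h2 := Nat.pow_right_injective hS h1
    lia
  · rintro _ ⟨N, hN, rfl⟩
    rw [mem_ofPred_eq] at hN
    have hh := heightT_approx_le (Fq := Fq) hq hr hl hm0 hm j N
    refine ⟨isAlgT_approx hr hl hm0 hm j N, (degT_approx_le hr hl hm0 hm j N).trans hn, ?_⟩
    rw [absC_iota_sub_iota hq, hN]
    refine ⟨by positivity, ?_⟩
    have hexp : (rr r m (j + 1) : ℝ) ^ (N + 2) =
        ((rr r m j * rr r m (j + 1) ^ N : ℕ) : ℝ) * ((rr r m (j + 1) : ℝ) ^ 2 / rr r m j) := by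
      have : (rr r m j : ℝ) ≠ 0 := by positivity
      push_cast
      field_simp
      ring
    rw [show -((rr r m (j + 1) : ℝ) ^ 2 / rr r m j - 1) - 1 = -((rr r m (j + 1) : ℝ) ^ 2 / rr r m j)
      by ring, Real.rpow_neg hh.1.le]
    refine inv_anti₀ (Real.rpow_pos_of_pos hh.1 _) ?_
    refine (Real.rpow_le_rpow hh.1.le hh.2 (by positivity)).trans_eq ?_
    rw [← Real.rpow_natCast, ← Real.rpow_mul (by positivity), ← hexp, ← Nat.cast_pow, Real.rpow_natCast]

/-- There are finitely many algebraic elements of bounded degree and of height one. -/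
theorem finite_isMinPolyOf_heightExp_eq_zero [Finite Fq] (n : ℕ) :
    {α : AC Fq | ∃ P, IsMinPolyOf Fq α P ∧ P.natDegree ≤ n ∧ heightExp P = 0}.Finite := by
  have hfin : {P : Polynomial (Polynomial Fq) | P.natDegree ≤ n ∧ heightExp P = 0}.Finite := by
    refine Set.Finite.of_injOn (f := fun P (i : Fin (n + 1)) => (P.coeff i).coeff 0)
      (mapsTo_univ _ _) ?_ finite_univ
    have hconst : ∀ P : Polynomial (Polynomial Fq), heightExp P = 0 →
        ∀ i, P.coeff i = C ((P.coeff i).coeff 0) := by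
      intro P hP i
      by_cases hi : i ∈ P.support
      · refine eq_C_of_natDegree_eq_zero (Nat.le_zero.1 (hP ▸ ?_))
        exact Finset.le_sup (f := fun i => (P.coeff i).natDegree) hi
      · rw [notMem_support_iff.1 hi, coeff_zero, C_0]
    rintro P ⟨hPn, hP⟩ Q ⟨hQn, hQ⟩ h
    refine Polynomial.ext fun i => ?_
    by_cases hi : i < n + 1
    · rw [hconst P hP i, hconst Q hQ i]
      exact congrArg C (congrFun h ⟨i, hi⟩)
    · rw [coeff_eq_zero_of_natDegree_lt (by lia), coeff_eq_zero_of_natDegree_lt (by lia)]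
  refine (hfin.biUnion fun P _ => (P.map (ringHomTC Fq)).roots.toFinset.finite_toSet).subset ?_
  rintro α ⟨P, hP, hn, hh⟩
  refine mem_biUnion (show P ∈ {P | _} from ⟨hn, hh⟩) ?_
  rw [Finset.mem_coe, Multiset.mem_toFinset, mem_roots, IsRoot.def, ← evalPC_eq_eval_map]
  · exact hP.2.2.2.2
  · exact (Polynomial.map_ne_zero_iff ringHomTC_injective).2 hP.2.1.ne_zero

/-- Elements of degree at most `n` and height `q^h > 1` are not too close to `ξ` if
`r_{j+1} ≥ 2 n r_j`. -/
theorem inv_pow_le_absoluteValue_xi_sub {p : ℕ} [Fact p.Prime] [CharP Fq p] {q : ℕ} (hq : 1 < q)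
    {w : AbsoluteValue (AC Fq) ℝ} (hna : IsNonarchimedean w)
    (hw : ∀ x, w (iota Fq x) = absL Fq q x) {r l : ℕ}
    (hr : 1 < r) (hl : r = p ^ l) {m : ℕ → ℕ} (hm0 : m 0 = 1) (hm : ∀ j, 1 ≤ j → 2 ≤ m j)
    {j n : ℕ} (hjn : 2 * n * rr r m j ≤ rr r m (j + 1)) {α : AC Fq}
    {P : Polynomial (Polynomial Fq)} (hP : IsMinPolyOf Fq α P) (hn : P.natDegree ≤ n)
    (hh : heightExp P ≠ 0) :
    ((q : ℝ) ^ ((rr r m j + 2 * n * rr r m j ^ 2 * rr r m (j + 1) ^ 2) * heightExp P))⁻¹ ≤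
      w (iota Fq (xi Fq r m) - α) := by
  have hq' : (1 : ℝ) < q := by exact_mod_cast hq
  have hR := one_lt_rr hr hm0 hm j
  have hS := one_lt_rr hr hm0 hm (j + 1)
  have hRk : rr r m j = p ^ (l * partialProd m j) := by rw [rr_eq, hl, pow_mul]
  have hk : 0 < l * partialProd m j := by
    by_contra h
    rw [Nat.eq_zero_of_not_pos h, pow_zero] at hRk
    lia
  set h := heightExp P with hhdef
  set R := rr r m j with hRdef
  set S := rr r m (j + 1) with hSdef
  set N := Nat.log S (2 * R * h) with hN
  have hN1 : S ^ N ≤ 2 * R * h := Nat.pow_log_le_self _ (by positivity)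
  have hN2 : 2 * R * h < S ^ (N + 1) := Nat.lt_pow_succ_log_self hS _
  obtain ⟨N', hNN', hN'2, hne⟩ :
      ∃ N', N ≤ N' ∧ N' ≤ N + 2 ∧ α ≠ iota Fq (approx Fq r m j N') := by
    by_contra! hcon
    exact approx_ne_approx_add_two (Fq := Fq) hr hm0 hm j N ((iota Fq).injective
      ((hcon N le_rfl (by lia)).symm.trans (hcon (N + 2) (by lia) le_rfl)))
  obtain ⟨c, hc, hroot⟩ := exists_artinSchreier_approx (Fq := Fq) hr hl hm0 hm j N'
  rw [← hRdef, ← hSdef] at hc hroot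
  have hL := zpow_neg_le_absoluteValue_sub hq hna hw hk hc hP.2.1 hP.1 hP.2.2.2.2
    (by rwa [← hRk]) hne
  rw [← hRk] at hL
  have hSN' : S ^ N' ≤ 2 * R * h * S ^ 2 :=
    calc S ^ N' ≤ S ^ (N + 2) := Nat.pow_le_pow_right (by lia) hN'2
      _ = S ^ N * S ^ 2 := pow_add _ _ _
      _ ≤ _ := Nat.mul_le_mul_right _ hN1
  have hdeg : R * S ^ N' * P.natDegree ≤ R * S ^ N' * n := Nat.mul_le_mul_left _ hn
  have hlt : R * S ^ N' * P.natDegree + R * h < S ^ (N' + 1) := by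
    have h1 : 2 * n * R * S ^ N' ≤ S * S ^ N' := Nat.mul_le_mul_right _ hjn
    have h2 : S ^ (N + 1) ≤ S ^ (N' + 1) := Nat.pow_le_pow_right (by lia) (by lia)
    rw [pow_succ'] at h2 ⊢
    rw [pow_succ' S N'] at h2
    rw [pow_succ' S N] at hN2
    nlinarith
  have hxi : w (iota Fq (xi Fq r m) - iota Fq (approx Fq r m j N')) <
      w (iota Fq (approx Fq r m j N') - α) := by
    rw [← map_sub, hw]
    refine (absL_xi_sub_approx_le hq hr hm0 hm j N').trans_lt (lt_of_lt_of_le ?_ hL)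
    exact inv_strictAnti₀ (by positivity) (pow_lt_pow_right₀ hq' hlt)
  have hle : w (iota Fq (approx Fq r m j N') - α) ≤ w (iota Fq (xi Fq r m) - α) := by
    by_contra! hlt'
    have h1 := hna (iota Fq (approx Fq r m j N') - iota Fq (xi Fq r m)) (iota Fq (xi Fq r m) - α)
    rw [sub_add_sub_cancel, w.map_sub _ (iota Fq (xi Fq r m))] at h1
    exact absurd h1 (not_le.2 (max_lt hxi hlt'))
  refine le_trans (inv_anti₀ (by positivity) (pow_le_pow_right₀ hq'.le ?_)) (hL.trans hle)
  have h3 : R * S ^ N' * n ≤ R * (2 * R * h * S ^ 2) * n :=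
    Nat.mul_le_mul_right _ (Nat.mul_le_mul_left _ hSN')
  calc R * S ^ N' * P.natDegree + R * h ≤ R * (2 * R * h * S ^ 2) * n + R * h := by lia
    _ = _ := by ring

/-- The upper bound for `w_n^*(ξ)` when `r_{j+1} ≥ 2 n r_j`. -/
theorem wnStar_le [Finite Fq] {p : ℕ} [Fact p.Prime] [CharP Fq p] {q : ℕ} (hq : 1 < q) {r l : ℕ}
    (hr : 1 < r) (hl : r = p ^ l) {m : ℕ → ℕ} (hm0 : m 0 = 1) (hm : ∀ j, 1 ≤ j → 2 ≤ m j)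
    {j n : ℕ} (hjn : 2 * n * rr r m j ≤ rr r m (j + 1)) :
    wnStar Fq q n (xi Fq r m) ≤
      (((rr r m j + 2 * n * rr r m j ^ 2 * rr r m (j + 1) ^ 2 : ℕ) : ℝ) : EReal) := by
  obtain ⟨w, hna, hw, hwC⟩ := exists_absC_absoluteValue Fq hq
  have hq' : (1 : ℝ) < q := by exact_mod_cast hq
  refine sSup_le ?_
  rintro _ ⟨x, hx, rfl⟩
  refine EReal.coe_le_coe_iff.2 ?_
  by_contra! hlt
  refine hx ((finite_isMinPolyOf_heightExp_eq_zero (Fq := Fq) n).subset ?_)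
  rintro α ⟨hα, hdeg, _, hle⟩
  obtain ⟨P, hP, hd, hH⟩ := hα.exists_isMinPolyOf_degT_heightT q
  refine ⟨P, hP, hd ▸ hdeg, ?_⟩
  by_contra hh
  have h1 := inv_pow_le_absoluteValue_xi_sub hq hna hw hr hl hm0 hm hjn hP (hd ▸ hdeg) hh
  rw [hwC] at h1
  have h2 := h1.trans hle
  rw [hH, ← Real.rpow_natCast, ← Real.rpow_neg (by positivity), ← Real.rpow_natCast,
    ← Real.rpow_mul (by positivity), Real.rpow_le_rpow_left_iff hq'] at h2
  have hh' : (0 : ℝ) < heightExp P := by exact_mod_cast Nat.pos_of_ne_zero hh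
  rw [Nat.cast_mul] at h2
  nlinarith

theorem lt_rr {r : ℕ} (hr : 1 < r) {m : ℕ → ℕ} (hm0 : m 0 = 1)
    (hm : ∀ j, 1 ≤ j → 2 ≤ m j) (j : ℕ) : j < rr r m j :=
  (lt_partialProd hm0 hm j).trans (Nat.lt_pow_self hr)

theorem rr_mono {r : ℕ} (hr : 1 < r) {m : ℕ → ℕ} (hm0 : m 0 = 1)
    (hm : ∀ j, 1 ≤ j → 2 ≤ m j) : Monotone (rr r m) := by
  intro i j h
  refine Nat.pow_le_pow_right (by lia) (Nat.le_of_dvd ?_ (partialProd_dvd m h))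
  exact (Nat.zero_le _).trans_lt (lt_partialProd hm0 hm j)

theorem rr_sq_le_rr_succ {r : ℕ} (hr : 1 < r) {m : ℕ → ℕ}
    (hm : ∀ j, 1 ≤ j → 2 ≤ m j) (j : ℕ) : rr r m j ^ 2 ≤ rr r m (j + 1) := by
  rw [rr_succ]
  exact Nat.pow_le_pow_right (rr_pos hr m j) (hm _ (by lia))

theorem exists_two_mul_rr_le {r : ℕ} (hr : 1 < r) {m : ℕ → ℕ} (hm0 : m 0 = 1)
    (hm : ∀ j, 1 ≤ j → 2 ≤ m j) (n : ℕ) : ∃ j, 2 * n * rr r m j ≤ rr r m (j + 1) := by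
  refine ⟨2 * n, le_trans ?_ (rr_sq_le_rr_succ hr hm _)⟩
  rw [sq]
  exact Nat.mul_le_mul_right _ (lt_rr hr hm0 hm _).le

/-- For large `n` one can choose `j` with `r_{j+1} ≥ 2 n r_j` and `r_j < 4 n ^ 2`. -/
theorem exists_rr_lt_and_le {r : ℕ} (hr : 1 < r) {m : ℕ → ℕ} (hm0 : m 0 = 1)
    (hm : ∀ j, 1 ≤ j → 2 ≤ m j) {J n : ℕ} (hJ : 1 ≤ J) (hn : rr r m J ≤ n) :
    ∃ j ≥ J, 2 * n * rr r m j ≤ rr r m (j + 1) ∧ rr r m j < 4 * n ^ 2 := by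
  have hex := exists_two_mul_rr_le hr hm0 hm n
  have hJle : J ≤ Nat.find hex := by
    by_contra! hlt
    have h1 := Nat.find_spec hex
    have h2 : rr r m (Nat.find hex + 1) ≤ n := (rr_mono hr hm0 hm hlt).trans hn
    have h3 := rr_pos hr m (Nat.find hex)
    have h4 := rr_pos hr m (Nat.find hex + 1)
    nlinarith
  refine ⟨Nat.find hex, hJle, Nat.find_spec hex, ?_⟩
  obtain ⟨i, hi⟩ : ∃ i, Nat.find hex = i + 1 := ⟨Nat.find hex - 1, by lia⟩
  have hnot := Nat.find_min hex (m := i) (by lia)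
  have hsq := rr_sq_le_rr_succ hr hm i
  rw [hi]
  have hlt : rr r m i < 2 * n := by
    by_contra! h
    nlinarith
  nlinarith

/-- The numerical estimate behind the upper bound for the type. -/
theorem add_mul_pow_le_pow {R n μ : ℕ} (hμ : 2 ≤ μ) (hn : 16 ≤ n) (hR : 1 ≤ R)
    (hRn : R < 4 * n ^ 2) :
    R + 2 * n * R ^ 2 * (R ^ μ) ^ 2 ≤ n ^ (2 + 8 * μ) := by
  have h1 : R ≤ n * R ^ (2 + 2 * μ) :=
    calc R = 1 * R ^ 1 := by ring
      _ ≤ n * R ^ (2 + 2 * μ) := Nat.mul_le_mul (by lia) (Nat.pow_le_pow_right hR (by lia))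
  have h2 : R ^ (2 + 2 * μ) ≤ (n ^ 5) ^ (1 + μ) :=
    calc R ^ (2 + 2 * μ) = (R ^ 2) ^ (1 + μ) := by rw [← pow_mul]; ring_nf
      _ ≤ ((4 * n ^ 2) ^ 2) ^ (1 + μ) := by gcongr
      _ = (16 * n ^ 4) ^ (1 + μ) := by ring_nf
      _ ≤ (n * n ^ 4) ^ (1 + μ) := by gcongr
      _ = (n ^ 5) ^ (1 + μ) := by ring_nf
  calc R + 2 * n * R ^ 2 * (R ^ μ) ^ 2 = R + 2 * (n * R ^ (2 + 2 * μ)) := by ring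
    _ ≤ 3 * n * R ^ (2 + 2 * μ) := by lia
    _ ≤ n * n * (n ^ 5) ^ (1 + μ) := by gcongr; lia
    _ = n ^ (7 + 5 * μ) := by ring
    _ ≤ n ^ (2 + 8 * μ) := Nat.pow_le_pow_right (by lia) (by lia)

theorem wnStar_ne_top [Finite Fq] {p : ℕ} [Fact p.Prime] [CharP Fq p] {q : ℕ} (hq : 1 < q)
    {r l : ℕ} (hr : 1 < r) (hl : r = p ^ l) {m : ℕ → ℕ} (hm0 : m 0 = 1)
    (hm : ∀ j, 1 ≤ j → 2 ≤ m j) (n : ℕ) : wnStar Fq q n (xi Fq r m) ≠ ⊤ := by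
  obtain ⟨j, hj⟩ := exists_two_mul_rr_le hr hm0 hm n
  exact ne_top_of_le_ne_top (EReal.coe_ne_top _) (wnStar_le hq hr hl hm0 hm hj)

theorem le_toReal_wnStar [Finite Fq] {p : ℕ} [Fact p.Prime] [CharP Fq p] {q : ℕ} (hq : 1 < q)
    {r l : ℕ} (hr : 1 < r) (hl : r = p ^ l) {m : ℕ → ℕ} (hm0 : m 0 = 1)
    (hm : ∀ j, 1 ≤ j → 2 ≤ m j) {j n : ℕ} (hn : rr r m j ≤ n) :
    (rr r m j : ℝ) ^ (2 * m (j + 1) - 1) - 1 ≤ (wnStar Fq q n (xi Fq r m)).toReal := by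
  have h := le_wnStar (Fq := Fq) hq hr hl hm0 hm hn
  have h2 := EReal.toReal_le_toReal h (EReal.coe_ne_bot _) (wnStar_ne_top hq hr hl hm0 hm n)
  rw [EReal.toReal_coe] at h2
  convert h2 using 2
  have hR : (rr r m j : ℝ) ≠ 0 := by exact_mod_cast (rr_pos hr m j).ne'
  have hμ := hm (j + 1) (by lia)
  rw [rr_succ, Nat.cast_pow, ← pow_mul, eq_div_iff hR, ← pow_succ]
  congr 1
  lia

theorem log_wnStar_div_log_le [Finite Fq] {p : ℕ} [Fact p.Prime] [CharP Fq p] {q : ℕ}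
    (hq : 1 < q) {r l : ℕ} (hr : 1 < r) (hl : r = p ^ l) {m : ℕ → ℕ} (hm0 : m 0 = 1)
    (hm : ∀ j, 1 ≤ j → 2 ≤ m j) {J n : ℕ} (hJ : 1 ≤ J) (hJn : rr r m J ≤ n) (hn : 16 ≤ n) :
    ∃ j ≥ J, Real.log (wnStar Fq q n (xi Fq r m)).toReal / Real.log n ≤ 2 + 8 * m (j + 1) := by
  obtain ⟨j, hjJ, hj, hj'⟩ := exists_rr_lt_and_le hr hm0 hm hJ hJn
  refine ⟨j, hjJ, ?_⟩
  have hlow := le_toReal_wnStar (Fq := Fq) hq hr hl hm0 hm hJn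
  have hR : (1 : ℝ) ≤ rr r m J := by exact_mod_cast rr_pos hr m J
  have h0 : 0 ≤ (wnStar Fq q n (xi Fq r m)).toReal :=
    le_trans (by linarith [one_le_pow₀ hR (n := 2 * m (J + 1) - 1)]) hlow
  have hup : (wnStar Fq q n (xi Fq r m)).toReal ≤ (n : ℝ) ^ (2 + 8 * m (j + 1)) := by
    have h1 := EReal.toReal_le_toReal (wnStar_le (Fq := Fq) hq hr hl hm0 hm hj)
      (ne_bot_of_le_ne_bot (EReal.coe_ne_bot _) (le_wnStar hq hr hl hm0 hm hJn))
      (EReal.coe_ne_top _)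
    rw [EReal.toReal_coe, rr_succ] at h1
    refine h1.trans ?_
    exact_mod_cast add_mul_pow_le_pow (hm (j + 1) (by lia)) hn (rr_pos hr m j) hj'
  have hlog : 0 < Real.log n := Real.log_pos (by exact_mod_cast (by lia : 1 < n))
  rw [div_le_iff₀ hlog]
  rcases h0.eq_or_lt with h | h
  · rw [← h, Real.log_zero]
    positivity
  · refine (Real.log_le_log h hup).trans_eq ?_
    rw [Real.log_pow]
    push_cast
    rfl

theorem two_add_eight_mul_le {p : ℕ} (hp : 2 ≤ p) {m : ℕ → ℕ} (hm : ∀ j, 1 ≤ j → 2 ≤ m j)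
    {j : ℕ} (hj : 1 ≤ j) :
    2 + 8 * m (j + 1) ≤ m j + 2 * ∏ i ∈ Finset.Icc j (j + p), m i := by
  have hsub : ∏ i ∈ Finset.Icc j (j + 2), m i ≤ ∏ i ∈ Finset.Icc j (j + p), m i := by
    refine Finset.prod_le_prod_of_subset_of_one_le' (Finset.Icc_subset_Icc_right (by lia)) ?_
    intro i hi _
    rw [Finset.mem_Icc] at hi
    have := hm i (by lia)
    lia
  have h3 : ∏ i ∈ Finset.Icc j (j + 2), m i = m j * m (j + 1) * m (j + 2) := by
    rw [Finset.prod_Icc_succ_top (by lia), Finset.prod_Icc_succ_top (by lia), Finset.Icc_self,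
      Finset.prod_singleton]
  rw [h3] at hsub
  have h4 : 2 * m (j + 1) * 2 ≤ m j * m (j + 1) * m (j + 2) :=
    Nat.mul_le_mul (Nat.mul_le_mul_right _ (hm j hj)) (hm (j + 2) (by lia))
  have := hm j hj
  lia

theorem typeTStar_xi_le [Finite Fq] {p : ℕ} [Fact p.Prime] [CharP Fq p] {q : ℕ}
    (hq : 1 < q) {r l : ℕ} (hr : 1 < r) (hl : r = p ^ l) {m : ℕ → ℕ} (hm0 : m 0 = 1)
    (hm : ∀ j, 1 ≤ j → 2 ≤ m j) :
    typeTStar Fq q (xi Fq r m) ≤ limsup (fun j : ℕ =>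
      (((m j : ℝ) + 2 * ∏ i ∈ Finset.Icc j (j + p), (m i : ℝ) : ℝ) : EReal)) atTop := by
  refine le_of_le_of_eq (le_iInf fun J => ?_) limsup_eq_iInf_iSup_of_nat.symm
  refine limsup_le_of_le (by isBoundedDefault) ?_
  filter_upwards [eventually_ge_atTop (rr r m (J + 1)), eventually_ge_atTop 16] with n hJn hn
  obtain ⟨j, hj, hle⟩ := log_wnStar_div_log_le (Fq := Fq) hq hr hl hm0 hm (by lia) hJn hn
  have hJj : J ≤ j := by lia
  refine le_iSup₂_of_le j hJj (EReal.coe_le_coe_iff.2 (hle.trans ?_))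
  exact_mod_cast two_add_eight_mul_le (Fact.out : p.Prime).two_le hm (by lia : 1 ≤ j)

theorem le_log_wnStar_div_log [Finite Fq] {p : ℕ} [Fact p.Prime] [CharP Fq p] {q : ℕ}
    (hq : 1 < q) {r l : ℕ} (hr : 1 < r) (hl : r = p ^ l) {m : ℕ → ℕ} (hm0 : m 0 = 1)
    (hm : ∀ j, 1 ≤ j → 2 ≤ m j) (j : ℕ) :
    2 * (m (j + 1) : ℝ) - 1 ≤
      Real.log (wnStar Fq q (rr r m j) (xi Fq r m)).toReal / Real.log (rr r m j) +
        Real.log 2 / Real.log (rr r m j) := by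
  have hlow := le_toReal_wnStar (Fq := Fq) hq hr hl hm0 hm (le_refl (rr r m j))
  have hμ := hm (j + 1) (by lia)
  have hR : (2 : ℝ) ≤ rr r m j := by exact_mod_cast one_lt_rr hr hm0 hm j
  have hlog : 0 < Real.log (rr r m j) := Real.log_pos (by linarith)
  have hpow : (2 : ℝ) ≤ (rr r m j : ℝ) ^ (2 * m (j + 1) - 1) :=
    hR.trans (le_self_pow₀ (by linarith) (by lia))
  rw [← add_div, le_div_iff₀ hlog, ← Real.log_mul (by linarith) two_ne_zero]
  have hcast : (2 * (m (j + 1) : ℝ) - 1) = ((2 * m (j + 1) - 1 : ℕ) : ℝ) := by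
    rw [Nat.cast_sub (by lia)]
    push_cast
    rfl
  rw [hcast, ← Real.log_pow]
  exact Real.log_le_log (by linarith) (by linarith)

theorem le_typeTStar_xi [Finite Fq] {p : ℕ} [Fact p.Prime] [CharP Fq p] {q : ℕ}
    (hq : 1 < q) {r l : ℕ} (hr : 1 < r) (hl : r = p ^ l) {m : ℕ → ℕ} (hm0 : m 0 = 1)
    (hm : ∀ j, 1 ≤ j → 2 ≤ m j) :
    limsup (fun j : ℕ => ((2 * (m j : ℝ) - 1 : ℝ) : EReal)) atTop ≤
      typeTStar Fq q (xi Fq r m) := by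
  have hrr : Tendsto (rr r m) atTop atTop :=
    tendsto_atTop_mono (fun j => (lt_rr hr hm0 hm j).le) tendsto_id
  have herr : Tendsto (fun j => ((Real.log 2 / Real.log (rr r m j) : ℝ) : EReal)) atTop
      (nhds ((0 : ℝ) : EReal)) := by
    refine (continuous_coe_real_ereal.tendsto 0).comp (Tendsto.const_div_atTop ?_ _)
    exact Real.tendsto_log_atTop.comp (tendsto_natCast_atTop_atTop.comp hrr)
  rw [← limsup_nat_add _ 1]
  calc limsup (fun j : ℕ => ((2 * (m (j + 1) : ℝ) - 1 : ℝ) : EReal)) atTop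
      ≤ limsup ((fun j : ℕ => ((Real.log (wnStar Fq q (rr r m j) (xi Fq r m)).toReal /
          Real.log (rr r m j) : ℝ) : EReal)) +
          fun j => ((Real.log 2 / Real.log (rr r m j) : ℝ) : EReal)) atTop := by
        refine limsup_le_limsup (Eventually.of_forall fun j => ?_)
        rw [Pi.add_apply, ← EReal.coe_add, EReal.coe_le_coe_iff]
        exact le_log_wnStar_div_log hq hr hl hm0 hm j
    _ ≤ limsup (fun j : ℕ => ((Real.log (wnStar Fq q (rr r m j) (xi Fq r m)).toReal /
          Real.log (rr r m j) : ℝ) : EReal)) atTop +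
          limsup (fun j => ((Real.log 2 / Real.log (rr r m j) : ℝ) : EReal)) atTop := by
        refine EReal.limsup_add_le (Or.inr ?_) (Or.inr ?_) <;> rw [herr.limsup_eq]
        exacts [EReal.coe_ne_top _, EReal.coe_ne_bot _]
    _ = limsup ((fun n : ℕ => ((Real.log (wnStar Fq q n (xi Fq r m)).toReal /
          Real.log n : ℝ) : EReal)) ∘ rr r m) atTop := by
        rw [herr.limsup_eq, EReal.coe_zero, add_zero]
        rfl
    _ ≤ typeTStar Fq q (xi Fq r m) := by
        rw [limsup_comp]
        exact limsup_le_limsup_of_le hrr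

end OotoT

/-- `limsup_j (2 m_j − 1) ≤ t*(ξ(r,m)) ≤ limsup_j (m_j + 2 m_j m_{j+1} ⋯ m_{j+p})`. -/
theorem starType_bounds (p : ℕ) (hp : p.Prime) (q : ℕ) (hq : ∃ e : ℕ, 0 < e ∧ q = p ^ e)
    (Fq : Type) [Field Fq] [Fintype Fq] [CharP Fq p] (hcard : Fintype.card Fq = q)
    (r : ℕ) (hr : ∃ e : ℕ, 0 < e ∧ r = p ^ e)
    (m : ℕ → ℕ) (hm0 : m 0 = 1) (hm : ∀ j : ℕ, 1 ≤ j → 2 ≤ m j) :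
    Filter.limsup (fun j : ℕ => ((2 * (m j : ℝ) - 1 : ℝ) : EReal)) Filter.atTop
        ≤ typeTStar Fq q (xi Fq r m) ∧
      typeTStar Fq q (xi Fq r m)
        ≤ Filter.limsup (fun j : ℕ =>
            (((m j : ℝ) + 2 * ∏ i ∈ Finset.Icc j (j + p), (m i : ℝ) : ℝ) : EReal))
          Filter.atTop := by
  have : Fact p.Prime := ⟨hp⟩
  obtain ⟨e, he, hqe⟩ := hq
  obtain ⟨l, hl0, hl⟩ := hr
  have hq1 : 1 < q := hqe ▸ Nat.one_lt_pow he.ne' hp.one_lt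
  have hr1 : 1 < r := hl ▸ Nat.one_lt_pow hl0.ne' hp.one_lt
  exact ⟨le_typeTStar_xi hq1 hr1 hl hm0 hm, typeTStar_xi_le hq1 hr1 hl hm0 hm⟩
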